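/- A discrete memoryless two-level security wiretap channel p(y,z1,z2|x) (satisfying X → Z1 → Z2) is perfectly embeddable if there exists a pair of auxiliary random variables U and V satisfying the Markov chain U → V → X → (Y,Z1,Z2) such that I(U;Y) ≥ I(U;Z2), the marginal p(v,x) is an optimal solution to the maximization program max_{p(v,x)} [I(V;Y) − I(V;Z2)], and I(V;Y|U) − I(V;Z1|U) equals max_{p(w,x)} [I(W;Y) − I(W;Z1)] (the secrecy capacity of the wiretap channel p(y,z1|x)). -/

import Mathlib

open scoped BigOperators
noncomputable section

/-- A probability mass function on a finite type. -/
def IsPMF {α : Type*} [Fintype α] (p : α → ℝ) : Prop :=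
  (∀ a, 0 ≤ p a) ∧ ∑ a, p a = 1

/-- A discrete channel from `α` to `β`: every input determines a pmf on outputs. -/
def IsChannel {α β : Type*} [Fintype β] (W : α → β → ℝ) : Prop :=
  ∀ a, IsPMF (W a)

/-- Mutual information (in bits) of a joint pmf on `α × β`. -/
def mutInfo {α β : Type*} [Fintype α] [Fintype β] (p : α × β → ℝ) : ℝ :=
  ∑ ab : α × β,
    p ab * Real.logb 2 (p ab / ((∑ b, p (ab.1, b)) * (∑ a, p (a, ab.2))))

variable {𝒳 𝒴 𝒵₁ 𝒵₂ : Type} [Fintype 𝒳] [Fintype 𝒴] [Fintype 𝒵₁] [Fintype 𝒵₂]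

/-- The Markov chain `X → Z₁ → Z₂` for the channel `W : 𝒳 → 𝒴 × 𝒵₁ × 𝒵₂`:
the eavesdropper output `Z₂` is degraded with respect to `Z₁`. -/
def DegradedZ1Z2 (W : 𝒳 → 𝒴 × 𝒵₁ × 𝒵₂ → ℝ) : Prop :=
  ∃ q : 𝒵₁ → 𝒵₂ → ℝ, IsChannel q ∧
    ∀ x z₁ z₂, (∑ y, W x (y, z₁, z₂)) = (∑ y, ∑ z₂', W x (y, z₁, z₂')) * q z₁ z₂

/-- Joint pmf of messages, inputs and outputs induced by a (possibly stochastic) encoder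
`enc` used on the memoryless channel `W` with uniform independent messages. -/
def codeJoint {n K₁ K₂ : ℕ} (W : 𝒳 → 𝒴 × 𝒵₁ × 𝒵₂ → ℝ)
    (enc : Fin K₁ × Fin K₂ → (Fin n → 𝒳) → ℝ)
    (m : Fin K₁ × Fin K₂) (xs : Fin n → 𝒳) (ys : Fin n → 𝒴)
    (z1s : Fin n → 𝒵₁) (z2s : Fin n → 𝒵₂) : ℝ :=
  ((K₁ : ℝ) * (K₂ : ℝ))⁻¹ * enc m xs * ∏ i, W (xs i) (ys i, z1s i, z2s i)

/-- Average probability of a decoding error at the legitimate receiver. -/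
def errProb {n K₁ K₂ : ℕ} (W : 𝒳 → 𝒴 × 𝒵₁ × 𝒵₂ → ℝ)
    (enc : Fin K₁ × Fin K₂ → (Fin n → 𝒳) → ℝ)
    (dec : (Fin n → 𝒴) → Fin K₁ × Fin K₂) : ℝ :=
  ∑ m, ∑ xs, ∑ ys, ∑ z1s, ∑ z2s,
    if dec ys ≠ m then codeJoint W enc m xs ys z1s z2s else 0

/-- The information leakage `I(M₁,M₂; Z₂ⁿ)` to the weak eavesdropper realization. -/
def leakMZ2 {n K₁ K₂ : ℕ} (W : 𝒳 → 𝒴 × 𝒵₁ × 𝒵₂ → ℝ)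
    (enc : Fin K₁ × Fin K₂ → (Fin n → 𝒳) → ℝ) : ℝ :=
  mutInfo (fun q : (Fin K₁ × Fin K₂) × (Fin n → 𝒵₂) =>
    ∑ xs, ∑ ys, ∑ z1s, codeJoint W enc q.1 xs ys z1s q.2)

/-- The information leakage `I(M₁; Z₁ⁿ)` to the strong eavesdropper realization. -/
def leakM1Z1 {n K₁ K₂ : ℕ} (W : 𝒳 → 𝒴 × 𝒵₁ × 𝒵₂ → ℝ)
    (enc : Fin K₁ × Fin K₂ → (Fin n → 𝒳) → ℝ) : ℝ :=
  mutInfo (fun q : Fin K₁ × (Fin n → 𝒵₁) =>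
    ∑ m₂, ∑ xs, ∑ ys, ∑ z2s, codeJoint W enc (q.1, m₂) xs ys q.2 z2s)

/-- A rate pair `(R₁,R₂)` is achievable for the two-level security wiretap channel `W`:
there are codes of blocklength `n` whose rates are arbitrarily close to `(R₁,R₂)`, with
vanishing error probability at the legitimate receiver, vanishing normalized leakage
`(1/n) I(M₁,M₂;Z₂ⁿ)` of both messages to the weak eavesdropper realization, and vanishing
normalized leakage `(1/n) I(M₁;Z₁ⁿ)` of the high-security message to the strong one. -/
def Achievable (W : 𝒳 → 𝒴 × 𝒵₁ × 𝒵₂ → ℝ) (R₁ R₂ : ℝ) : Prop :=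
  ∀ ε > 0, ∃ n : ℕ, 0 < n ∧ ∃ K₁ K₂ : ℕ, 0 < K₁ ∧ 0 < K₂ ∧
    (n : ℝ) * (R₁ - ε) ≤ Real.logb 2 K₁ ∧ (n : ℝ) * (R₂ - ε) ≤ Real.logb 2 K₂ ∧
    ∃ enc : Fin K₁ × Fin K₂ → (Fin n → 𝒳) → ℝ, IsChannel enc ∧
      ∃ dec : (Fin n → 𝒴) → Fin K₁ × Fin K₂,
        errProb W enc dec ≤ ε ∧
        leakMZ2 W enc ≤ (n : ℝ) * ε ∧
        leakM1Z1 W enc ≤ (n : ℝ) * ε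

/-- Conditional mutual information `I(A;B|C)` (in bits) of a joint pmf on `α × β × γ`,
where the conditioning variable is the third coordinate. -/
def condMutInfo {α β γ : Type*} [Fintype α] [Fintype β] [Fintype γ]
    (p : α × β × γ → ℝ) : ℝ :=
  ∑ x : α × β × γ,
    p x * Real.logb 2
      (((∑ a, ∑ b, p (a, b, x.2.2)) * p x) /
        ((∑ b, p (x.1, b, x.2.2)) * (∑ a, p (a, x.2.1, x.2.2))))

/-- Marginal channel to the legitimate receiver. -/
def WY (W : 𝒳 → 𝒴 × 𝒵₁ × 𝒵₂ → ℝ) (x : 𝒳) (y : 𝒴) : ℝ := ∑ z₁, ∑ z₂, W x (y, z₁, z₂)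

/-- Marginal channel to the strong eavesdropper realization. -/
def WZ1 (W : 𝒳 → 𝒴 × 𝒵₁ × 𝒵₂ → ℝ) (x : 𝒳) (z₁ : 𝒵₁) : ℝ := ∑ y, ∑ z₂, W x (y, z₁, z₂)

/-- Marginal channel to the weak eavesdropper realization. -/
def WZ2 (W : 𝒳 → 𝒴 × 𝒵₁ × 𝒵₂ → ℝ) (x : 𝒳) (z₂ : 𝒵₂) : ℝ := ∑ y, ∑ z₁, W x (y, z₁, z₂)
/-- The secrecy capacity `max_{p(v,x)} [I(V;Y) − I(V;Z₂)]` of the wiretap channel to the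
weak eavesdropper realization, the supremum being over all joint distributions of the
input with an auxiliary random variable `V` on a finite alphabet. -/
def wiretapCapZ2 (W : 𝒳 → 𝒴 × 𝒵₁ × 𝒵₂ → ℝ) : ℝ :=
  sSup {r : ℝ | ∃ (k : ℕ) (p : Fin k × 𝒳 → ℝ), IsPMF p ∧
    r = mutInfo (fun q : Fin k × 𝒴 => ∑ x, p (q.1, x) * WY W x q.2) -
        mutInfo (fun q : Fin k × 𝒵₂ => ∑ x, p (q.1, x) * WZ2 W x q.2)}

/-- The secrecy capacity `max_{p(w,x)} [I(W;Y) − I(W;Z₁)]` of the wiretap channel to the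
strong eavesdropper realization. -/
def wiretapCapZ1 (W : 𝒳 → 𝒴 × 𝒵₁ × 𝒵₂ → ℝ) : ℝ :=
  sSup {r : ℝ | ∃ (k : ℕ) (p : Fin k × 𝒳 → ℝ), IsPMF p ∧
    r = mutInfo (fun q : Fin k × 𝒴 => ∑ x, p (q.1, x) * WY W x q.2) -
        mutInfo (fun q : Fin k × 𝒵₁ => ∑ x, p (q.1, x) * WZ1 W x q.2)}

/-- A two-level security wiretap channel is perfectly embeddable if some achievable rate
pair has `R₁` equal to the secrecy capacity of the wiretap channel `p(y,z₁|x)` and sum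
rate equal to the secrecy capacity of the wiretap channel `p(y,z₂|x)`. -/
def PerfectlyEmbeddable (W : 𝒳 → 𝒴 × 𝒵₁ × 𝒵₂ → ℝ) : Prop :=
  ∃ R₁ R₂ : ℝ, 0 ≤ R₁ ∧ 0 ≤ R₂ ∧ Achievable W R₁ R₂ ∧
    R₁ = wiretapCapZ1 W ∧ R₁ + R₂ = wiretapCapZ2 W

section


/-! ### Basic inequalities -/

lemma gibbs_ratio {ι : Type*} [Fintype ι] (p r : ι → ℝ) (hp : ∀ i, 0 ≤ p i)
    (hr : ∀ i, 0 < p i → 0 < r i) (hs : ∑ i, p i * (r i)⁻¹ ≤ ∑ i, p i) :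
    0 ≤ ∑ i, p i * Real.logb 2 (r i) := by
  have h2 : 0 < Real.log 2 := Real.log_pos (by norm_num)
  have key : ∀ i, p i - p i * (r i)⁻¹ ≤ Real.log 2 * (p i * Real.logb 2 (r i)) := by
    intro i
    rcases (hp i).eq_or_lt with h | h
    · simp [← h]
    · have := Real.one_sub_inv_le_log_of_pos (hr i h)
      have e : Real.log 2 * (p i * Real.logb 2 (r i)) = p i * Real.log (r i) := by
        unfold Real.logb; field_simp
      rw [e]
      nlinarith
  have := Finset.sum_le_sum (fun i (_ : i ∈ Finset.univ) => key i)
  rw [Finset.sum_sub_distrib, ← Finset.mul_sum] at this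
  have h3 : 0 ≤ Real.log 2 * ∑ i, p i * Real.logb 2 (r i) := by linarith
  exact nonneg_of_mul_nonneg_right h3 h2

lemma IsPMF.le_marg_left {α β : Type*} [Fintype α] [Fintype β] {p : α × β → ℝ}
    (hp : ∀ a, 0 ≤ p a) (a : α) (b : β) : p (a, b) ≤ ∑ b', p (a, b') :=
  Finset.single_le_sum (f := fun b' => p (a, b')) (fun _ _ => hp _) (Finset.mem_univ b)

lemma IsPMF.le_marg_right {α β : Type*} [Fintype α] [Fintype β] {p : α × β → ℝ}
    (hp : ∀ a, 0 ≤ p a) (a : α) (b : β) : p (a, b) ≤ ∑ a', p (a', b) :=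
  Finset.single_le_sum (f := fun a' => p (a', b)) (fun _ _ => hp _) (Finset.mem_univ a)

lemma mutInfo_nonneg {α β : Type*} [Fintype α] [Fintype β] {p : α × β → ℝ}
    (hp : IsPMF p) : 0 ≤ mutInfo p := by
  unfold mutInfo
  apply gibbs_ratio
  · exact hp.1
  · rintro ⟨a, b⟩ h
    exact div_pos h (mul_pos (h.trans_le (IsPMF.le_marg_left hp.1 a b))
      (h.trans_le (IsPMF.le_marg_right hp.1 a b)))
  · rw [hp.2]
    calc _ ≤ ∑ ab : α × β, (∑ b, p (ab.1, b)) * (∑ a, p (a, ab.2)) := by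
            apply Finset.sum_le_sum
            rintro ⟨a, b⟩ _
            have h1 : 0 ≤ ∑ b', p (a, b') := Finset.sum_nonneg fun _ _ => hp.1 _
            have h2 : 0 ≤ ∑ a', p (a', b) := Finset.sum_nonneg fun _ _ => hp.1 _
            by_cases h : p (a, b) = 0
            · simp only [h, zero_mul]; positivity
            · rw [inv_div, mul_div_cancel₀ _ h]
      _ = 1 := by
            rw [Fintype.sum_prod_type]
            simp only
            rw [← Finset.sum_mul_sum, ← Fintype.sum_prod_type, ← Fintype.sum_prod_type_right (f := p), hp.2]
            norm_num

/-- disintegration of a nonnegative joint function -/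
lemma exists_disint {α β : Type*} [Fintype β] (f : α → β → ℝ) (hf : ∀ a b, 0 ≤ f a b)
    (r : β → ℝ) (hr : IsPMF r) :
    ∃ k : α → β → ℝ, IsChannel k ∧ ∀ a b, (∑ b', f a b') * k a b = f a b := by
  classical
  refine ⟨fun a b => if (∑ b', f a b') = 0 then r b else f a b / ∑ b', f a b', ?_, ?_⟩
  · intro a
    by_cases h : (∑ b', f a b') = 0
    · simpa [h] using hr
    · simp only [h, if_false]
      refine ⟨fun b => div_nonneg (hf _ _) (Finset.sum_nonneg fun _ _ => hf _ _), ?_⟩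
      rw [← Finset.sum_div, div_self h]
  · intro a b
    by_cases h : (∑ b', f a b') = 0
    · have : f a b = 0 := (Finset.sum_eq_zero_iff_of_nonneg (fun _ _ => hf _ _)).1 h b (Finset.mem_univ b)
      simp [h, this]
    · simp only [h, if_false]
      field_simp

/-! ### Single-letter quantities -/

section single
variable {U V Z Z' : Type*} [Fintype U] [Fintype V] [Fintype Z] [Fintype Z']

/-- output law given the cloud center -/
def TU (q : U → V → ℝ) (T : U → V → Z → ℝ) (u : U) (z : Z) : ℝ := ∑ v, q u v * T u v z
/-- output law -/
def TQ (pU : U → ℝ) (q : U → V → ℝ) (T : U → V → Z → ℝ) (z : Z) : ℝ := ∑ u, pU u * TU q T u z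

structure Sys (pU : U → ℝ) (q : U → V → ℝ) (T : U → V → Z → ℝ) : Prop where
  pU : IsPMF pU
  q : IsChannel q
  T : ∀ u, IsChannel (T u)

variable {pU : U → ℝ} {q : U → V → ℝ} {T : U → V → Z → ℝ}

lemma Sys.TU_chan (h : Sys pU q T) : IsChannel (TU q T) := by
  intro u
  refine ⟨fun z => Finset.sum_nonneg fun v _ => mul_nonneg ((h.q u).1 v) ((h.T u v).1 z), ?_⟩
  unfold TU
  rw [Finset.sum_comm]
  simp_rw [← Finset.mul_sum, (h.T u _).2, mul_one]
  exact (h.q u).2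

lemma Sys.TQ_pmf (h : Sys pU q T) : IsPMF (TQ pU q T) := by
  refine ⟨fun z => Finset.sum_nonneg fun u _ => mul_nonneg (h.pU.1 u) ((h.TU_chan u).1 z), ?_⟩
  unfold TQ
  rw [Finset.sum_comm]
  simp_rw [← Finset.mul_sum, (h.TU_chan _).2, mul_one]
  exact h.pU.2

lemma Sys.le_TU (h : Sys pU q T) (u v z) : q u v * T u v z ≤ TU q T u z :=
  Finset.single_le_sum (f := fun v => q u v * T u v z)
    (fun v _ => mul_nonneg ((h.q u).1 v) ((h.T u v).1 z)) (Finset.mem_univ v)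

lemma Sys.le_TQ (h : Sys pU q T) (u z) : pU u * TU q T u z ≤ TQ pU q T z :=
  Finset.single_le_sum (f := fun u => pU u * TU q T u z)
    (fun u _ => mul_nonneg (h.pU.1 u) ((h.TU_chan u).1 z)) (Finset.mem_univ u)

/-- positivity of all the factors -/
lemma Sys.pos (h : Sys pU q T) {u v z} (hp : 0 < pU u * q u v * T u v z) :
    0 < pU u ∧ 0 < q u v ∧ 0 < T u v z ∧ 0 < TU q T u z ∧ 0 < TQ pU q T z := by
  have h1 := h.pU.1 u
  have h2 := (h.q u).1 v
  have h3 := (h.T u v).1 z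
  have e1 : 0 < pU u := h1.lt_of_ne (by rintro e; simp [← e] at hp)
  have e2 : 0 < q u v := h2.lt_of_ne (by rintro e; simp [← e] at hp)
  have e3 : 0 < T u v z := h3.lt_of_ne (by rintro e; simp [← e] at hp)
  have e4 : 0 < TU q T u z := (mul_pos e2 e3).trans_le (h.le_TU u v z)
  exact ⟨e1, e2, e3, e4, (mul_pos e1 e4).trans_le (h.le_TQ u z)⟩

lemma Sys.nonneg (h : Sys pU q T) (u v z) : 0 ≤ pU u * q u v * T u v z :=
  mul_nonneg (mul_nonneg (h.pU.1 u) ((h.q u).1 v)) ((h.T u v).1 z)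

lemma Sys.sum_one (h : Sys pU q T) : ∑ u, ∑ v, ∑ z, pU u * q u v * T u v z = 1 := by
  simp_rw [← Finset.mul_sum, (h.T _ _).2, mul_one, ← Finset.mul_sum, (h.q _).2, mul_one]
  exact h.pU.2

/-- `I(U;Z)` -/
def infU (pU : U → ℝ) (q : U → V → ℝ) (T : U → V → Z → ℝ) : ℝ :=
  ∑ u, ∑ v, ∑ z, pU u * q u v * T u v z * Real.logb 2 (TU q T u z / TQ pU q T z)
/-- `I(V;Z|U)` -/
def infVU (pU : U → ℝ) (q : U → V → ℝ) (T : U → V → Z → ℝ) : ℝ :=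
  ∑ u, ∑ v, ∑ z, pU u * q u v * T u v z * Real.logb 2 (T u v z / TU q T u z)
/-- `I(U,V;Z)` -/
def infUV (pU : U → ℝ) (q : U → V → ℝ) (T : U → V → Z → ℝ) : ℝ :=
  ∑ u, ∑ v, ∑ z, pU u * q u v * T u v z * Real.logb 2 (T u v z / TQ pU q T z)

lemma Sys.chain (h : Sys pU q T) : infUV pU q T = infU pU q T + infVU pU q T := by
  unfold infUV infU infVU
  simp_rw [← Finset.sum_add_distrib]
  refine Finset.sum_congr rfl fun u _ => Finset.sum_congr rfl fun v _ =>
    Finset.sum_congr rfl fun z _ => ?_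
  rcases (h.nonneg u v z).eq_or_lt with e | e
  · simp [← e]
  · obtain ⟨_, _, h3, h4, h5⟩ := h.pos e
    rw [← mul_add, ← Real.logb_mul (by positivity) (by positivity)]
    congr 2
    field_simp

lemma Sys.mutInfo_U (h : Sys pU q T) :
    mutInfo (fun s : U × Z => ∑ v, pU s.1 * q s.1 v * T s.1 v s.2) = infU pU q T := by
  have e : ∀ u z, ∑ v, pU u * q u v * T u v z = pU u * TU q T u z := by
    intro u z; unfold TU; rw [Finset.mul_sum]; simp only [mul_assoc]
  unfold mutInfo infU
  simp only [e, Fintype.sum_prod_type]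
  refine Finset.sum_congr rfl fun u _ => ?_
  rw [Finset.sum_comm]
  refine Finset.sum_congr rfl fun z _ => ?_
  rw [← Finset.sum_mul, e]
  rw [← Finset.mul_sum, (h.TU_chan u).2, mul_one]
  change _ * Real.logb 2 (_ / (_ * TQ pU q T z)) = _
  by_cases h0 : pU u = 0
  · simp [h0]
  · rw [mul_div_mul_left _ _ h0]

lemma Sys.condMutInfo_VU (h : Sys pU q T) :
    condMutInfo (fun t : V × Z × U => pU t.2.2 * q t.2.2 t.1 * T t.2.2 t.1 t.2.1)
      = infVU pU q T := by
  have e : ∀ u z, ∑ v, pU u * q u v * T u v z = pU u * TU q T u z := by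
    intro u z; unfold TU; rw [Finset.mul_sum]; simp only [mul_assoc]
  unfold condMutInfo infVU
  simp only [Fintype.sum_prod_type, e]
  simp_rw [← Finset.mul_sum, (h.T _ _).2, mul_one, ← Finset.mul_sum, (h.q _).2, mul_one]
  have : ∀ F : U → V → Z → ℝ, ∑ u, ∑ v, ∑ z, F u v z = ∑ v, ∑ z, ∑ u, F u v z := by
    intro F
    rw [Finset.sum_comm]
    exact Finset.sum_congr rfl fun v _ => Finset.sum_comm
  rw [this]
  refine Finset.sum_congr rfl fun v _ => Finset.sum_congr rfl fun z _ =>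
    Finset.sum_congr rfl fun u _ => ?_
  rcases (h.nonneg u v z).eq_or_lt with e | e
  · simp [← e]
  · obtain ⟨h1, h2, h3, h4, h5⟩ := h.pos e
    congr 2
    field_simp

lemma Sys.mutInfo_V (h : Sys pU q T)
    (hM : ∀ u v z, pU u * q u v * T u v z * (∑ u', pU u' * q u' v) =
      pU u * q u v * ∑ u', pU u' * q u' v * T u' v z) :
    mutInfo (fun s : V × Z => ∑ u, pU u * q u s.1 * T u s.1 s.2) = infUV pU q T := by
  unfold mutInfo infUV
  simp only [Fintype.sum_prod_type]
  have : ∀ F : U → V → Z → ℝ, ∑ u, ∑ v, ∑ z, F u v z = ∑ v, ∑ z, ∑ u, F u v z := by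
    intro F
    rw [Finset.sum_comm]
    exact Finset.sum_congr rfl fun v _ => Finset.sum_comm
  rw [this]
  have e1 : ∀ v, ∑ z, ∑ u, pU u * q u v * T u v z = ∑ u, pU u * q u v := by
    intro v; rw [Finset.sum_comm]
    simp_rw [← Finset.mul_sum, (h.T _ _).2, mul_one]
  have e2 : ∀ z, ∑ v, ∑ u, pU u * q u v * T u v z = TQ pU q T z := by
    intro z; rw [Finset.sum_comm]
    unfold TQ TU
    simp_rw [Finset.mul_sum, mul_assoc]
  simp only [e1, e2]
  refine Finset.sum_congr rfl fun v _ => Finset.sum_congr rfl fun z _ => ?_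
  rw [Finset.sum_mul]
  refine Finset.sum_congr rfl fun u _ => ?_
  rcases (h.nonneg u v z).eq_or_lt with e | e
  · simp [← e]
  · obtain ⟨h1, h2, h3, h4, h5⟩ := h.pos e
    have h6 : 0 < ∑ u', pU u' * q u' v := (mul_pos h1 h2).trans_le
      (Finset.single_le_sum (f := fun u' => pU u' * q u' v)
        (fun u' _ => mul_nonneg (h.pU.1 u') ((h.q u').1 v)) (Finset.mem_univ u))
    have := hM u v z
    have h7 : ∑ u', pU u' * q u' v * T u' v z = T u v z * ∑ u', pU u' * q u' v := by
      have h8 : pU u * q u v ≠ 0 := by positivity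
      apply mul_left_cancel₀ h8
      rw [← this]; ring
    rw [h7]
    congr 2
    field_simp

lemma Sys.infU_nonneg (h : Sys pU q T) : 0 ≤ infU pU q T := by
  rw [← h.mutInfo_U]
  apply mutInfo_nonneg
  refine ⟨fun s => Finset.sum_nonneg fun v _ => h.nonneg _ _ _, ?_⟩
  rw [Fintype.sum_prod_type, ← h.sum_one]
  exact Finset.sum_congr rfl fun u _ => Finset.sum_comm

lemma Sys.infVU_nonneg (h : Sys pU q T) : 0 ≤ infVU pU q T := by
  have := gibbs_ratio (ι := U × V × Z) (fun s => pU s.1 * q s.1 s.2.1 * T s.1 s.2.1 s.2.2)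
    (fun s => T s.1 s.2.1 s.2.2 / TU q T s.1 s.2.2) (fun s => h.nonneg _ _ _)
    (fun s hs => by
      obtain ⟨h1, h2, h3, h4, h5⟩ := h.pos hs
      exact div_pos h3 h4) (by
      simp only [Fintype.sum_prod_type]
      rw [h.sum_one]
      calc _ ≤ ∑ u, ∑ v, ∑ z, pU u * q u v * TU q T u z := by
            refine Finset.sum_le_sum fun u _ => Finset.sum_le_sum fun v _ =>
              Finset.sum_le_sum fun z _ => ?_
            have a1 := h.pU.1 u
            have a2 := (h.q u).1 v
            have a3 := (h.TU_chan u).1 z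
            by_cases h0 : T u v z = 0
            · simp only [h0, mul_zero, zero_mul]; positivity
            · rw [inv_div, mul_assoc, mul_div_cancel₀ _ h0]
        _ = 1 := by
            simp_rw [← Finset.mul_sum, (h.TU_chan _).2, mul_one, ← Finset.mul_sum,
              (h.q _).2, mul_one]
            exact h.pU.2)
  simp only [Fintype.sum_prod_type] at this
  exact this

lemma Sys.dpi (h : Sys pU q T) (d : Z → Z' → ℝ) (hd : IsChannel d)
    (T' : U → V → Z' → ℝ) (hT' : ∀ u v z', T' u v z' = ∑ z, T u v z * d z z') :
    infVU pU q T' ≤ infVU pU q T := by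
  have h' : Sys pU q T' := ⟨h.pU, h.q, fun u v => by
    refine ⟨fun z' => ?_, ?_⟩
    · rw [hT']; exact Finset.sum_nonneg fun z _ => mul_nonneg ((h.T u v).1 z) ((hd z).1 z')
    · simp_rw [hT']; rw [Finset.sum_comm]
      simp_rw [← Finset.mul_sum, (hd _).2, mul_one]; exact (h.T u v).2⟩
  have hTU' : ∀ u z', TU q T' u z' = ∑ z, TU q T u z * d z z' := by
    intro u z'
    unfold TU
    simp_rw [hT', Finset.mul_sum, Finset.sum_mul]
    rw [Finset.sum_comm]
    simp only [mul_assoc]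
  have hnn : ∀ u v z z', 0 ≤ pU u * q u v * T u v z * d z z' := fun u v z z' =>
    mul_nonneg (h.nonneg u v z) ((hd z).1 z')
  have hpos : ∀ u v z z', 0 < pU u * q u v * T u v z * d z z' →
      0 < T u v z ∧ 0 < TU q T u z ∧ 0 < T' u v z' ∧ 0 < TU q T' u z' := by
    intro u v z z' hp
    have a1 := h.nonneg u v z
    have a2 : 0 < pU u * q u v * T u v z := a1.lt_of_ne (by rintro e; simp [← e] at hp)
    have a3 : 0 < d z z' := ((hd z).1 z').lt_of_ne (by rintro e; simp [← e] at hp)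
    obtain ⟨h1, h2, h3, h4, h5⟩ := h.pos a2
    have a4 : 0 < T' u v z' := by
      rw [hT']
      exact (mul_pos h3 a3).trans_le (Finset.single_le_sum (f := fun z => T u v z * d z z')
        (fun z _ => mul_nonneg ((h.T u v).1 z) ((hd z).1 z')) (Finset.mem_univ z))
    exact ⟨h3, h4, a4, (h'.pos (by positivity : 0 < pU u * q u v * T' u v z')).2.2.2.1⟩
  have e1 : infVU pU q T = ∑ u, ∑ v, ∑ z, ∑ z', pU u * q u v * T u v z * d z z' *
      Real.logb 2 (T u v z / TU q T u z) := by
    unfold infVU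
    refine Finset.sum_congr rfl fun u _ => Finset.sum_congr rfl fun v _ =>
      Finset.sum_congr rfl fun z _ => ?_
    rw [← Finset.sum_mul, ← Finset.mul_sum, (hd z).2, mul_one]
  have e2 : infVU pU q T' = ∑ u, ∑ v, ∑ z, ∑ z', pU u * q u v * T u v z * d z z' *
      Real.logb 2 (T' u v z' / TU q T' u z') := by
    unfold infVU
    refine Finset.sum_congr rfl fun u _ => Finset.sum_congr rfl fun v _ => ?_
    rw [Finset.sum_comm]
    refine Finset.sum_congr rfl fun z' _ => ?_
    rw [← Finset.sum_mul]
    congr 1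
    rw [hT', Finset.mul_sum]
    simp only [mul_assoc]
  have := gibbs_ratio (ι := U × V × Z × Z')
    (fun s => pU s.1 * q s.1 s.2.1 * T s.1 s.2.1 s.2.2.1 * d s.2.2.1 s.2.2.2)
    (fun s => (T s.1 s.2.1 s.2.2.1 / TU q T s.1 s.2.2.1) /
      (T' s.1 s.2.1 s.2.2.2 / TU q T' s.1 s.2.2.2)) (fun s => hnn _ _ _ _)
    (fun s hs => by
      obtain ⟨h1, h2, h3, h4⟩ := hpos _ _ _ _ hs
      positivity) (by
      simp only [Fintype.sum_prod_type]
      have r1 : ∑ u, ∑ v, ∑ z, ∑ z', pU u * q u v * T u v z * d z z' = 1 := by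
        simp_rw [← Finset.mul_sum, (hd _).2, mul_one]; exact h.sum_one
      rw [r1]
      calc _ ≤ ∑ u, ∑ v, ∑ z, ∑ z', pU u * q u v * (T' u v z' / TU q T' u z') *
              (TU q T u z * d z z') := by
            refine Finset.sum_le_sum fun u _ => Finset.sum_le_sum fun v _ =>
              Finset.sum_le_sum fun z _ => Finset.sum_le_sum fun z' _ => ?_
            have a1 := h.pU.1 u
            have a2 := (h.q u).1 v
            have a3 := (h.TU_chan u).1 z
            have a4 := (hd z).1 z'
            have a5 := (h'.TU_chan u).1 z'
            have a6 := (h'.T u v).1 z'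
            rcases (hnn u v z z').eq_or_lt with e | e
            · rw [← e]; simp only [zero_mul]; positivity
            · obtain ⟨h1, h2, h3, h4⟩ := hpos _ _ _ _ e
              apply le_of_eq
              field_simp
        _ = ∑ u, ∑ v, ∑ z', pU u * q u v * (T' u v z' / TU q T' u z') * TU q T' u z' := by
            refine Finset.sum_congr rfl fun u _ => Finset.sum_congr rfl fun v _ => ?_
            rw [Finset.sum_comm]
            refine Finset.sum_congr rfl fun z' _ => ?_
            rw [← Finset.mul_sum, hTU']
        _ ≤ ∑ u, ∑ v, ∑ z', pU u * q u v * T' u v z' := by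
            refine Finset.sum_le_sum fun u _ => Finset.sum_le_sum fun v _ =>
              Finset.sum_le_sum fun z' _ => ?_
            have a5 := h'.nonneg u v z'
            by_cases h0 : TU q T' u z' = 0
            · rw [h0, mul_zero]; exact a5
            · rw [mul_assoc, div_mul_cancel₀ _ h0]
        _ = 1 := h'.sum_one)
  rw [← sub_nonneg, e1, e2]
  simp only [← Finset.sum_sub_distrib]
  simp only [Fintype.sum_prod_type] at this
  convert this using 8 with u _ v _ z _ z' _
  rcases (hnn u v z z').eq_or_lt with e | e
  · simp [← e]
  · obtain ⟨h1, h2, h3, h4⟩ := hpos _ _ _ _ e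
    rw [← mul_sub, ← Real.logb_div (by positivity) (by positivity)]

end single
end

section


/-! ### Random superposition codebooks -/

lemma sum_prod_pi {ι κ : Type*} [Fintype ι] [DecidableEq ι] [Fintype κ] (f : ι → κ → ℝ) :
    ∑ c : ι → κ, ∏ i, f i (c i) = ∏ i, ∑ a, f i a := by
  rw [Finset.prod_univ_sum, Fintype.piFinset_univ]

lemma pi_pmf {ι κ : Type*} [Fintype ι] [DecidableEq ι] [Fintype κ] {P : κ → ℝ} (hP : IsPMF P) :
    IsPMF (fun c : ι → κ => ∏ i, P (c i)) := by
  refine ⟨fun c => Finset.prod_nonneg fun i _ => hP.1 _, ?_⟩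
  rw [sum_prod_pi (fun _ => P)]
  simp [hP.2]

lemma pi_two {ι κ : Type*} [Fintype ι] [DecidableEq ι] [Fintype κ] {P : κ → ℝ} (hP : IsPMF P)
    (g h : κ → ℝ) {a b : ι} (hab : a ≠ b) :
    ∑ c : ι → κ, (∏ i, P (c i)) * (g (c a) * h (c b)) = (∑ x, P x * g x) * ∑ x, P x * h x := by
  have e : ∀ c : ι → κ, (∏ i, P (c i)) * (g (c a) * h (c b)) =
      ∏ i, (P (c i) * (if i = a then g (c i) else 1) * (if i = b then h (c i) else 1)) := by
    intro c
    rw [Finset.prod_mul_distrib, Finset.prod_mul_distrib]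
    simp [Finset.prod_ite_eq', mul_assoc]
  simp_rw [e]
  rw [sum_prod_pi (fun i x => P x * (if i = a then g x else 1) * (if i = b then h x else 1))]
  have e2 : ∀ i, ∑ x, P x * (if i = a then g x else 1) * (if i = b then h x else 1) =
      (if i = a then ∑ x, P x * g x else 1) * (if i = b then ∑ x, P x * h x else 1) := by
    intro i
    by_cases h1 : i = a
    · have h2 : i ≠ b := fun e => hab (h1.symm.trans e)
      simp [h1, hab]
    · by_cases h2 : i = b
      · simp [h2, Ne.symm hab]
      · simp [h1, h2, hP.2]
  simp_rw [e2]
  rw [Finset.prod_mul_distrib]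
  simp

lemma pi_one {ι κ : Type*} [Fintype ι] [DecidableEq ι] [Fintype κ] {P : κ → ℝ} (hP : IsPMF P)
    (g : κ → ℝ) (a : ι) :
    ∑ c : ι → κ, (∏ i, P (c i)) * g (c a) = ∑ x, P x * g x := by
  have e : ∀ c : ι → κ, (∏ i, P (c i)) * g (c a) =
      ∏ i, (P (c i) * (if i = a then g (c i) else 1)) := by
    intro c
    rw [Finset.prod_mul_distrib]
    simp [Finset.prod_ite_eq']
  simp_rw [e]
  rw [sum_prod_pi (fun i x => P x * (if i = a then g x else 1))]
  have e2 : ∀ i, ∑ x, P x * (if i = a then g x else 1) =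
      (if i = a then ∑ x, P x * g x else 1) := by
    intro i
    by_cases h1 : i = a
    · simp [h1]
    · simp [h1, hP.2]
  simp_rw [e2]
  simp

section oneshot
variable {U V Z I J : Type*} [Fintype U] [Fintype V] [Fintype Z] [Fintype I] [Fintype J]
  [DecidableEq I] [DecidableEq J]

/-- law of one cloud -/
def cloudP (pU : U → ℝ) (q : U → V → ℝ) (a : U × (J → V)) : ℝ := pU a.1 * ∏ j, q a.1 (a.2 j)
/-- law of the codebook -/
def cbP (pU : U → ℝ) (q : U → V → ℝ) (c : I → U × (J → V)) : ℝ := ∏ i, cloudP pU q (c i)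

variable {pU : U → ℝ} {q : U → V → ℝ}

lemma cloud_pmf (hp : IsPMF pU) (hq : IsChannel q) :
    IsPMF (cloudP pU q : U × (J → V) → ℝ) := by
  refine ⟨fun a => mul_nonneg (hp.1 _) (Finset.prod_nonneg fun j _ => (hq _).1 _), ?_⟩
  rw [Fintype.sum_prod_type]
  unfold cloudP
  simp_rw [← Finset.mul_sum]
  simp_rw [(pi_pmf (hq _)).2, mul_one]
  exact hp.2

lemma cb_pmf (hp : IsPMF pU) (hq : IsChannel q) :
    IsPMF (cbP pU q : (I → U × (J → V)) → ℝ) := pi_pmf (cloud_pmf hp hq)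

lemma cloud_one (hq : IsChannel q) (k : U → V → ℝ) (j : J) :
    ∑ a : U × (J → V), cloudP pU q a * k a.1 (a.2 j) = ∑ u, ∑ v, pU u * q u v * k u v := by
  rw [Fintype.sum_prod_type]
  unfold cloudP
  refine Finset.sum_congr rfl fun u _ => ?_
  simp only [mul_assoc]
  rw [← Finset.mul_sum, pi_one (hq u) (k u) j, Finset.mul_sum]

lemma cloud_two (hq : IsChannel q) (k f : U → V → ℝ) {j j' : J} (hj : j ≠ j') :
    ∑ a : U × (J → V), cloudP pU q a * (k a.1 (a.2 j) * f a.1 (a.2 j')) =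
      ∑ u, ∑ v, pU u * q u v * (k u v * ∑ v', q u v' * f u v') := by
  rw [Fintype.sum_prod_type]
  unfold cloudP
  refine Finset.sum_congr rfl fun u _ => ?_
  simp only [mul_assoc]
  rw [← Finset.mul_sum, pi_two (hq u) (k u) (f u) hj, Finset.sum_mul, Finset.mul_sum]
  simp only [mul_assoc]

lemma cb_one (hp : IsPMF pU) (hq : IsChannel q) (k : U → V → ℝ) (i : I) (j : J) :
    ∑ c : I → U × (J → V), cbP pU q c * k (c i).1 ((c i).2 j) =
      ∑ u, ∑ v, pU u * q u v * k u v := by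
  unfold cbP
  rw [pi_one (cloud_pmf hp hq) (fun a => k a.1 (a.2 j)) i, cloud_one hq]

lemma cb_mean (hp : IsPMF pU) (hq : IsChannel q) (k f : U → V → ℝ) (I' : Finset I)
    (J' : Finset J) {i : I} {j : J} (hi : i ∈ I') (hj : j ∈ J') :
    ∑ c : I → U × (J → V), cbP pU q c * (k (c i).1 ((c i).2 j) *
        ∑ i' ∈ I', ∑ j' ∈ J', f (c i').1 ((c i').2 j')) =
      ∑ u, ∑ v, pU u * q u v * (k u v * (f u v + (J'.card - 1 : ℝ) * (∑ v', q u v' * f u v') +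
        (I'.card - 1 : ℝ) * J'.card * ∑ u', pU u' * ∑ v', q u' v' * f u' v')) := by
  have e0 : ∑ c : I → U × (J → V), cbP pU q c * (k (c i).1 ((c i).2 j) *
        ∑ i' ∈ I', ∑ j' ∈ J', f (c i').1 ((c i').2 j')) =
      ∑ i' ∈ I', ∑ j' ∈ J', ∑ c : I → U × (J → V), cbP pU q c * (k (c i).1 ((c i).2 j) *
        f (c i').1 ((c i').2 j')) := by
    simp_rw [Finset.mul_sum]
    rw [Finset.sum_comm]
    refine Finset.sum_congr rfl fun i' _ => Finset.sum_comm
  have same : ∀ j' ∈ J', ∑ c : I → U × (J → V), cbP pU q c * (k (c i).1 ((c i).2 j) *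
        f (c i).1 ((c i).2 j')) = if j' = j then ∑ u, ∑ v, pU u * q u v * (k u v * f u v) else
        ∑ u, ∑ v, pU u * q u v * (k u v * ∑ v', q u v' * f u v') := by
    intro j' _
    split_ifs with h
    · subst h
      exact cb_one hp hq (fun u v => k u v * f u v) i j'
    · unfold cbP
      rw [pi_one (cloud_pmf hp hq) (fun a => k a.1 (a.2 j) * f a.1 (a.2 j')) i,
        cloud_two hq k f (Ne.symm h)]
  have diff : ∀ i' ∈ I'.erase i, ∀ j' ∈ J', ∑ c : I → U × (J → V),
      cbP pU q c * (k (c i).1 ((c i).2 j) * f (c i').1 ((c i').2 j')) =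
      (∑ u, ∑ v, pU u * q u v * k u v) * ∑ u', pU u' * ∑ v', q u' v' * f u' v' := by
    intro i' hi' j' _
    unfold cbP
    rw [pi_two (cloud_pmf hp hq) (fun a => k a.1 (a.2 j)) (fun a => f a.1 (a.2 j'))
      (Finset.ne_of_mem_erase hi').symm, cloud_one hq, cloud_one hq]
    simp_rw [Finset.mul_sum, mul_assoc]
  rw [e0, ← Finset.add_sum_erase _ _ hi, Finset.sum_congr rfl same,
    ← Finset.add_sum_erase _ _ hj]
  rw [Finset.sum_congr rfl (fun i' hi' => Finset.sum_congr rfl (diff i' hi'))]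
  have e5 : ∀ j' ∈ J'.erase j, (if j' = j then ∑ u, ∑ v, pU u * q u v * (k u v * f u v) else
        ∑ u, ∑ v, pU u * q u v * (k u v * ∑ v', q u v' * f u v')) =
        ∑ u, ∑ v, pU u * q u v * (k u v * ∑ v', q u v' * f u v') := fun j' hj' => by
    rw [if_neg (Finset.ne_of_mem_erase hj')]
  rw [Finset.sum_congr rfl e5]
  simp only [if_true, Finset.sum_const, nsmul_eq_mul]
  have c1 : ((I'.erase i).card : ℝ) = I'.card - 1 := by
    rw [Finset.card_erase_of_mem hi, Nat.cast_sub (Finset.card_pos.2 ⟨i, hi⟩)]; simp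
  have c2 : ((J'.erase j).card : ℝ) = J'.card - 1 := by
    rw [Finset.card_erase_of_mem hj, Nat.cast_sub (Finset.card_pos.2 ⟨j, hj⟩)]; simp
  rw [c1, c2]
  simp only [mul_add, Finset.sum_add_distrib]
  congr 1
  · congr 1
    rw [Finset.mul_sum]
    refine Finset.sum_congr rfl fun u _ => ?_
    rw [Finset.mul_sum]
    refine Finset.sum_congr rfl fun v _ => ?_
    ring
  · set Q := ∑ u', pU u' * ∑ v', q u' v' * f u' v'
    have e6 : ∀ X : ℝ, (I'.card - 1 : ℝ) * (J'.card * (X * Q)) =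
      ((I'.card - 1 : ℝ) * J'.card * Q) * X := fun X => by ring
    rw [e6, Finset.mul_sum]
    refine Finset.sum_congr rfl fun u _ => ?_
    rw [Finset.mul_sum]
    refine Finset.sum_congr rfl fun v _ => ?_
    ring

/-- the mean of the codebook sum given the transmitted codeword -/
def mval (pU : U → ℝ) (q : U → V → ℝ) (T : U → V → Z → ℝ) (a b : ℕ) (u : U) (v : V) (z : Z) : ℝ :=
  T u v z + (b - 1 : ℝ) * TU q T u z + (a - 1 : ℝ) * b * TQ pU q T z

variable {T : U → V → Z → ℝ}

lemma Sys.le_mval (h : Sys pU q T) {a b : ℕ} (ha : 0 < a) (hb : 0 < b) (u v z) :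
    T u v z ≤ mval pU q T a b u v z := by
  have a1 := (h.TU_chan u).1 z
  have a2 := h.TQ_pmf.1 z
  have a3 : (1:ℝ) ≤ a := by exact_mod_cast ha
  have a4 : (1:ℝ) ≤ b := by exact_mod_cast hb
  have : 0 ≤ (b - 1 : ℝ) * TU q T u z := mul_nonneg (by linarith) a1
  have : 0 ≤ (a - 1 : ℝ) * b * TQ pU q T z :=
    mul_nonneg (mul_nonneg (by linarith) (by linarith)) a2
  unfold mval; linarith

lemma Sys.cb_log (h : Sys pU q T) (I' : Finset I)
    (J' : Finset J) {i : I} {j : J} (hi : i ∈ I') (hj : j ∈ J') (z : Z) :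
    ∑ c : I → U × (J → V), cbP pU q c * (T (c i).1 ((c i).2 j) z *
        Real.logb 2 (∑ i' ∈ I', ∑ j' ∈ J', T (c i').1 ((c i').2 j') z)) ≤
      ∑ u, ∑ v, pU u * q u v * T u v z *
        Real.logb 2 (mval pU q T I'.card J'.card u v z) := by
  have l2 : 0 < Real.log 2 := Real.log_pos (by norm_num)
  have hI : 0 < I'.card := Finset.card_pos.2 ⟨i, hi⟩
  have hJ : 0 < J'.card := Finset.card_pos.2 ⟨j, hj⟩
  set m : U → V → ℝ := fun u v => mval pU q T I'.card J'.card u v z with hm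
  have hP := cb_pmf (I := I) (J := J) h.pU h.q
  have key : ∀ c : I → U × (J → V), cbP pU q c * (T (c i).1 ((c i).2 j) z *
        Real.logb 2 (∑ i' ∈ I', ∑ j' ∈ J', T (c i').1 ((c i').2 j') z)) ≤
        cbP pU q c * (T (c i).1 ((c i).2 j) z * (Real.logb 2 (m (c i).1 ((c i).2 j)) -
          (Real.log 2)⁻¹)) + cbP pU q c * (T (c i).1 ((c i).2 j) z / m (c i).1 ((c i).2 j) *
          (Real.log 2)⁻¹ * ∑ i' ∈ I', ∑ j' ∈ J', T (c i').1 ((c i').2 j') z) := by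
    intro c
    rw [← mul_add]
    apply mul_le_mul_of_nonneg_left _ (hP.1 c)
    set t := T (c i).1 ((c i).2 j) z with ht
    have ht0 : 0 ≤ t := (h.T _ _).1 z
    set S := ∑ i' ∈ I', ∑ j' ∈ J', T (c i').1 ((c i').2 j') z with hS
    have htS : t ≤ S := by
      calc t ≤ ∑ j' ∈ J', T (c i).1 ((c i).2 j') z :=
            Finset.single_le_sum (f := fun j' => T (c i).1 ((c i).2 j') z)
              (fun j' _ => (h.T _ _).1 z) hj
        _ ≤ S := Finset.single_le_sum (f := fun i' => ∑ j' ∈ J', T (c i').1 ((c i').2 j') z)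
              (fun i' _ => Finset.sum_nonneg fun j' _ => (h.T _ _).1 z) hi
    have htm : t ≤ m (c i).1 ((c i).2 j) := h.le_mval hI hJ _ _ _
    set mm := m (c i).1 ((c i).2 j)
    rcases ht0.eq_or_lt with e | e
    · simp [← e]
    · have S0 : 0 < S := e.trans_le htS
      have m0 : 0 < mm := e.trans_le htm
      have l := Real.log_le_sub_one_of_pos (div_pos S0 m0)
      rw [Real.log_div S0.ne' m0.ne'] at l
      have : Real.logb 2 S ≤ Real.logb 2 mm - (Real.log 2)⁻¹ + S / mm * (Real.log 2)⁻¹ := by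
        unfold Real.logb
        have := mul_le_mul_of_nonneg_right l (inv_nonneg.2 l2.le)
        rw [div_eq_mul_inv, div_eq_mul_inv (Real.log mm)]
        linarith
      calc t * Real.logb 2 S ≤ t * (Real.logb 2 mm - (Real.log 2)⁻¹ + S / mm * (Real.log 2)⁻¹) :=
            mul_le_mul_of_nonneg_left this ht0
        _ = _ := by field_simp
  refine (Finset.sum_le_sum fun c _ => key c).trans ?_
  rw [Finset.sum_add_distrib]
  rw [cb_one h.pU h.q (fun u v => T u v z * (Real.logb 2 (m u v) - (Real.log 2)⁻¹)) i j,
    cb_mean h.pU h.q (fun u v => T u v z / m u v * (Real.log 2)⁻¹) (fun u v => T u v z) I' J' hi hj]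
  rw [← Finset.sum_add_distrib]
  refine Finset.sum_le_sum fun u _ => ?_
  rw [← Finset.sum_add_distrib]
  refine Finset.sum_le_sum fun v _ => ?_
  change _ + pU u * q u v * (T u v z / m u v * (Real.log 2)⁻¹ * m u v) ≤ _
  have ht0 : 0 ≤ T u v z := (h.T _ _).1 z
  have htm : T u v z ≤ m u v := h.le_mval hI hJ _ _ _
  apply le_of_eq
  rcases ht0.eq_or_lt with e | e
  · simp [← e]
  · have m0 : 0 < m u v := e.trans_le htm
    change _ = pU u * q u v * T u v z * Real.logb 2 (m u v)
    field_simp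
    ring

lemma Sys.cb_err (h : Sys pU q T) (I' : Finset I)
    (J' : Finset J) {i : I} {j : J} (hi : i ∈ I') (hj : j ∈ J') (z : Z) :
    ∑ c : I → U × (J → V), cbP pU q c * (T (c i).1 ((c i).2 j) z *
        (1 - T (c i).1 ((c i).2 j) z / (∑ i' ∈ I', ∑ j' ∈ J', T (c i').1 ((c i').2 j') z))) ≤
      ∑ u, ∑ v, pU u * q u v * T u v z *
        (1 - T u v z / mval pU q T I'.card J'.card u v z) := by
  have hI : 0 < I'.card := Finset.card_pos.2 ⟨i, hi⟩
  have hJ : 0 < J'.card := Finset.card_pos.2 ⟨j, hj⟩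
  set m : U → V → ℝ := fun u v => mval pU q T I'.card J'.card u v z with hm
  have hP := cb_pmf (I := I) (J := J) h.pU h.q
  have key : ∀ c : I → U × (J → V), cbP pU q c * (T (c i).1 ((c i).2 j) z *
        (1 - T (c i).1 ((c i).2 j) z / (∑ i' ∈ I', ∑ j' ∈ J', T (c i').1 ((c i').2 j') z))) ≤
        cbP pU q c * (T (c i).1 ((c i).2 j) z * (1 - 2 * T (c i).1 ((c i).2 j) z /
          m (c i).1 ((c i).2 j))) + cbP pU q c * ((T (c i).1 ((c i).2 j) z / m (c i).1 ((c i).2 j))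
          ^ 2 * ∑ i' ∈ I', ∑ j' ∈ J', T (c i').1 ((c i').2 j') z) := by
    intro c
    rw [← mul_add]
    apply mul_le_mul_of_nonneg_left _ (hP.1 c)
    set t := T (c i).1 ((c i).2 j) z with ht
    have ht0 : 0 ≤ t := (h.T _ _).1 z
    set S := ∑ i' ∈ I', ∑ j' ∈ J', T (c i').1 ((c i').2 j') z with hS
    have htS : t ≤ S := by
      calc t ≤ ∑ j' ∈ J', T (c i).1 ((c i).2 j') z :=
            Finset.single_le_sum (f := fun j' => T (c i).1 ((c i).2 j') z)
              (fun j' _ => (h.T _ _).1 z) hj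
        _ ≤ S := Finset.single_le_sum (f := fun i' => ∑ j' ∈ J', T (c i').1 ((c i').2 j') z)
              (fun i' _ => Finset.sum_nonneg fun j' _ => (h.T _ _).1 z) hi
    have htm : t ≤ m (c i).1 ((c i).2 j) := h.le_mval hI hJ _ _ _
    set mm := m (c i).1 ((c i).2 j)
    rcases ht0.eq_or_lt with e | e
    · simp [← e]
    · have S0 : 0 < S := e.trans_le htS
      have m0 : 0 < mm := e.trans_le htm
      rw [← sub_nonneg]
      have : t * (1 - 2 * t / mm) + (t / mm) ^ 2 * S - t * (1 - t / S) =
          t ^ 2 * (S - mm) ^ 2 / (mm ^ 2 * S) := by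
        field_simp
        ring
      rw [this]
      positivity
  refine (Finset.sum_le_sum fun c _ => key c).trans ?_
  rw [Finset.sum_add_distrib]
  rw [cb_one h.pU h.q (fun u v => T u v z * (1 - 2 * T u v z / m u v)) i j,
    cb_mean h.pU h.q (fun u v => (T u v z / m u v) ^ 2) (fun u v => T u v z) I' J' hi hj]
  rw [← Finset.sum_add_distrib]
  refine Finset.sum_le_sum fun u _ => ?_
  rw [← Finset.sum_add_distrib]
  refine Finset.sum_le_sum fun v _ => ?_
  change _ + pU u * q u v * ((T u v z / m u v) ^ 2 * m u v) ≤ _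
  have ht0 : 0 ≤ T u v z := (h.T _ _).1 z
  have htm : T u v z ≤ m u v := h.le_mval hI hJ _ _ _
  apply le_of_eq
  rcases ht0.eq_or_lt with e | e
  · simp [← e]
  · have m0 : 0 < m u v := e.trans_le htm
    change _ = pU u * q u v * T u v z * (1 - T u v z / m u v)
    field_simp
    ring

end oneshot
end

section


lemma leak_le {ι M Z : Type*} [Fintype ι] [Fintype M] [Fintype Z]
    (a : ι → M → Z → ℝ) (r : ι → Z → ℝ) (ha : ∀ i m z, 0 ≤ a i m z)
    (hs : ∑ i, ∑ m, ∑ z, a i m z = 1) (hr : ∀ i z, 0 ≤ r i z) (hrs : ∑ i, ∑ z, r i z ≤ 1)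
    (hac : ∀ i m z, r i z = 0 → a i m z = 0) :
    mutInfo (fun s : M × Z => ∑ i, a i s.1 s.2) ≤
      ∑ i, ∑ m, ∑ z, a i m z *
        Real.logb 2 (a i m z / ((∑ z', ∑ i', a i' m z') * r i z)) := by
  set j : M → Z → ℝ := fun m z => ∑ i, a i m z with hj
  set jM : M → ℝ := fun m => ∑ z, j m z with hjM
  set jZ : Z → ℝ := fun z => ∑ m, j m z with hjZ
  have j0 : ∀ m z, 0 ≤ j m z := fun m z => Finset.sum_nonneg fun i _ => ha i m z
  have jM0 : ∀ m, 0 ≤ jM m := fun m => Finset.sum_nonneg fun z _ => j0 m z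
  have jZ0 : ∀ z, 0 ≤ jZ z := fun z => Finset.sum_nonneg fun m _ => j0 m z
  have aj : ∀ i m z, a i m z ≤ j m z := fun i m z =>
    Finset.single_le_sum (f := fun i => a i m z) (fun i _ => ha i m z) (Finset.mem_univ i)
  have jjM : ∀ m z, j m z ≤ jM m := fun m z =>
    Finset.single_le_sum (f := fun z => j m z) (fun z _ => j0 m z) (Finset.mem_univ z)
  have jjZ : ∀ m z, j m z ≤ jZ z := fun m z =>
    Finset.single_le_sum (f := fun m => j m z) (fun m _ => j0 m z) (Finset.mem_univ m)
  have pos : ∀ i m z, 0 < a i m z → 0 < r i z ∧ 0 < j m z ∧ 0 < jM m ∧ 0 < jZ z := by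
    intro i m z h
    have h1 := h.trans_le (aj i m z)
    refine ⟨(hr i z).lt_of_ne fun e => ?_, h1, h1.trans_le (jjM m z), h1.trans_le (jjZ m z)⟩
    rw [hac i m z e.symm] at h
    exact lt_irrefl _ h
  have e1 : mutInfo (fun s : M × Z => ∑ i, a i s.1 s.2) =
      ∑ i, ∑ m, ∑ z, a i m z * Real.logb 2 (j m z / (jM m * jZ z)) := by
    unfold mutInfo
    rw [Fintype.sum_prod_type]
    rw [Finset.sum_comm (s := (Finset.univ : Finset ι))]
    refine Finset.sum_congr rfl fun m _ => ?_
    rw [Finset.sum_comm (s := (Finset.univ : Finset ι))]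
    refine Finset.sum_congr rfl fun z _ => ?_
    rw [← Finset.sum_mul]
  have g := gibbs_ratio (ι := ι × M × Z) (fun s => a s.1 s.2.1 s.2.2)
    (fun s => (a s.1 s.2.1 s.2.2 / (jM s.2.1 * r s.1 s.2.2)) /
      (j s.2.1 s.2.2 / (jM s.2.1 * jZ s.2.2))) (fun s => ha _ _ _) (fun s h => by
        obtain ⟨h1, h2, h3, h4⟩ := pos _ _ _ h
        positivity) (by
      simp only [Fintype.sum_prod_type]
      rw [hs]
      calc _ ≤ ∑ i, ∑ m, ∑ z, j m z * (r i z / jZ z) := by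
            refine Finset.sum_le_sum fun i _ => Finset.sum_le_sum fun m _ =>
              Finset.sum_le_sum fun z _ => ?_
            have a1 := j0 m z
            have a2 := hr i z
            have a3 := jZ0 z
            rcases (ha i m z).eq_or_lt with e | e
            · rw [← e, zero_mul]; positivity
            · obtain ⟨h1, h2, h3, h4⟩ := pos _ _ _ e
              apply le_of_eq
              field_simp
        _ = ∑ i, ∑ z, jZ z * (r i z / jZ z) := by
            refine Finset.sum_congr rfl fun i _ => ?_
            rw [Finset.sum_comm]
            refine Finset.sum_congr rfl fun z _ => ?_
            rw [← Finset.sum_mul]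
        _ ≤ ∑ i, ∑ z, r i z := by
            refine Finset.sum_le_sum fun i _ => Finset.sum_le_sum fun z _ => ?_
            by_cases h0 : jZ z = 0
            · rw [h0, zero_mul]; exact hr i z
            · rw [mul_div_cancel₀ _ h0]
        _ ≤ 1 := hrs)
  rw [e1, ← sub_nonneg]
  simp only [← Finset.sum_sub_distrib]
  simp only [Fintype.sum_prod_type] at g
  refine g.trans (le_of_eq ?_)
  refine Finset.sum_congr rfl fun i _ => Finset.sum_congr rfl fun m _ =>
    Finset.sum_congr rfl fun z _ => ?_
  rcases (ha i m z).eq_or_lt with e | e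
  · simp [← e]
  · obtain ⟨h1, h2, h3, h4⟩ := pos _ _ _ e
    rw [← mul_sub, ← Real.logb_div (by positivity) (by positivity)]

section oneshot
variable {U V Z I J : Type*} [Fintype U] [Fintype V] [Fintype Z] [Fintype I] [Fintype J]
  [DecidableEq I] [DecidableEq J]
variable {pU : U → ℝ} {q : U → V → ℝ} {T : U → V → Z → ℝ}

lemma Sys.cb_div (h : Sys pU q T) (I' : Finset I) (J' : Finset J) (N : ℝ) (r : U → ℝ) (z : Z) :
    ∑ c : I → U × (J → V), cbP pU q c * ∑ i ∈ I', ∑ j ∈ J', (T (c i).1 ((c i).2 j) z *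
        (Real.logb 2 (∑ i' ∈ I', ∑ j' ∈ J', T (c i').1 ((c i').2 j') z) -
          Real.logb 2 (N * r (c i).1))) ≤
      I'.card * J'.card * ∑ u, ∑ v, pU u * q u v * T u v z *
        (Real.logb 2 (mval pU q T I'.card J'.card u v z) - Real.logb 2 (N * r u)) := by
  have e0 : ∀ F : (I → U × (J → V)) → I → J → ℝ,
      ∑ c : I → U × (J → V), cbP pU q c * ∑ i ∈ I', ∑ j ∈ J', F c i j =
      ∑ i ∈ I', ∑ j ∈ J', ∑ c : I → U × (J → V), cbP pU q c * F c i j := by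
    intro F
    simp_rw [Finset.mul_sum]
    rw [Finset.sum_comm]
    exact Finset.sum_congr rfl fun i _ => Finset.sum_comm
  rw [e0]
  calc _ ≤ ∑ i ∈ I', ∑ j ∈ J', ∑ u, ∑ v, pU u * q u v * T u v z *
        (Real.logb 2 (mval pU q T I'.card J'.card u v z) - Real.logb 2 (N * r u)) := by
        refine Finset.sum_le_sum fun i hi => Finset.sum_le_sum fun j hj => ?_
        simp only [mul_sub, Finset.sum_sub_distrib]
        have h1 := h.cb_log I' J' hi hj z
        have h2 := cb_one h.pU h.q (fun u v => T u v z * Real.logb 2 (N * r u)) i j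
        simp only [← mul_assoc] at h1 h2 ⊢
        linarith
    _ = _ := by
        simp only [Finset.sum_const, nsmul_eq_mul, mul_assoc]

lemma cb_pos {c : I → U × (J → V)} (hp : IsPMF pU) (hq : IsChannel q) (hc : 0 < cbP pU q c) (i : I)
    (j : J) : 0 < pU (c i).1 ∧ 0 < q (c i).1 ((c i).2 j) := by
  have h1 : cloudP pU q (c i) ≠ 0 := fun e =>
    hc.ne' (Finset.prod_eq_zero (Finset.mem_univ i) e)
  have h2 : pU (c i).1 ≠ 0 := fun e => h1 (by simp [cloudP, e])
  have h3 : q (c i).1 ((c i).2 j) ≠ 0 := fun e => h1 (by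
    unfold cloudP
    rw [Finset.prod_eq_zero (Finset.mem_univ j) e, mul_zero])
  exact ⟨(hp.1 _).lt_of_ne' h2, ((hq _).1 _).lt_of_ne' h3⟩

lemma sum_mul_log_split {ι κ : Type*} (I' : Finset ι) (J' : Finset κ) (t : ι → κ → ℝ) (R : ι → ℝ)
    (ht : ∀ i j, 0 ≤ t i j)
    (hR : ∀ i j, 0 < t i j → 0 < R i) :
    ∑ i ∈ I', ∑ j ∈ J', t i j * Real.logb 2 ((∑ i' ∈ I', ∑ j' ∈ J', t i' j') / R i) =
    ∑ i ∈ I', ∑ j ∈ J', t i j * (Real.logb 2 (∑ i' ∈ I', ∑ j' ∈ J', t i' j') -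
      Real.logb 2 (R i)) := by
  refine Finset.sum_congr rfl fun i hi => Finset.sum_congr rfl fun j hj => ?_
  rcases (ht i j).eq_or_lt with e | e
  · simp [← e]
  · have : t i j ≤ ∑ i' ∈ I', ∑ j' ∈ J', t i' j' :=
      (Finset.single_le_sum (f := fun j' => t i j') (fun j' _ => ht _ _) hj).trans
      (Finset.single_le_sum (f := fun i' => ∑ j' ∈ J', t i' j')
        (fun i' _ => Finset.sum_nonneg fun j' _ => ht _ _) hi)
    rw [Real.logb_div (e.trans_le this).ne' (hR i j e).ne']

/-- the two-term soft-covering bound -/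
def bnd2 (pU : U → ℝ) (q : U → V → ℝ) (T : U → V → Z → ℝ) (b e : ℕ) : ℝ :=
  ∑ u, ∑ v, ∑ z, pU u * q u v * T u v z *
    (Real.logb 2 (1 + TU q T u z / TQ pU q T z / b) +
      Real.logb 2 (1 + T u v z / TQ pU q T z / (b * e)))
/-- the conditional soft-covering bound -/
def bnd1 (pU : U → ℝ) (q : U → V → ℝ) (T : U → V → Z → ℝ) (d : ℕ) : ℝ :=
  ∑ u, ∑ v, ∑ z, pU u * q u v * T u v z * Real.logb 2 (1 + T u v z / TU q T u z / d)
/-- the error bound -/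
def bndE (pU : U → ℝ) (q : U → V → ℝ) (T : U → V → Z → ℝ) (a b : ℕ) : ℝ :=
  ∑ u, ∑ v, ∑ z, pU u * q u v * T u v z * (1 - T u v z / mval pU q T a b u v z)

lemma Sys.le_bnd2 (h : Sys pU q T) {b e : ℕ} (hb : 0 < b) (he : 0 < e) (u v z) :
    pU u * q u v * T u v z *
      (Real.logb 2 (mval pU q T b e u v z) - Real.logb 2 ((b * e : ℝ) * TQ pU q T z)) ≤
    pU u * q u v * T u v z *
    (Real.logb 2 (1 + TU q T u z / TQ pU q T z / b) +
      Real.logb 2 (1 + T u v z / TQ pU q T z / (b * e))) := by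
  rcases (h.nonneg u v z).eq_or_lt with e0 | e0
  · simp [← e0]
  · obtain ⟨h1, h2, h3, h4, h5⟩ := h.pos e0
    have hb' : (1:ℝ) ≤ b := by exact_mod_cast hb
    have he' : (1:ℝ) ≤ e := by exact_mod_cast he
    have hm : 0 < mval pU q T b e u v z := h3.trans_le (h.le_mval hb he u v z)
    apply mul_le_mul_of_nonneg_left _ e0.le
    rw [← Real.logb_div hm.ne' (by positivity), ← Real.logb_mul (by positivity) (by positivity)]
    apply Real.logb_le_logb_of_le (by norm_num) (by positivity)
    rw [div_le_iff₀ (by positivity)]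
    have : (1 + TU q T u z / TQ pU q T z / b) * (1 + T u v z / TQ pU q T z / (b * e)) *
        (b * e * TQ pU q T z) = b * e * TQ pU q T z + e * TU q T u z + T u v z +
          TU q T u z * T u v z / (b * TQ pU q T z) := by
      field_simp
      ring
    rw [this]
    have h6 : 0 ≤ TU q T u z * T u v z / (b * TQ pU q T z) := by positivity
    unfold mval
    nlinarith [mul_pos (lt_of_lt_of_le one_pos he') h5]

lemma Sys.le_bnd1 (h : Sys pU q T) {d : ℕ} (hd : 0 < d) (u v z) :
    pU u * q u v * T u v z *
      (Real.logb 2 (mval pU q T 1 d u v z) - Real.logb 2 ((d : ℝ) * TU q T u z)) ≤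
    pU u * q u v * T u v z * Real.logb 2 (1 + T u v z / TU q T u z / d) := by
  rcases (h.nonneg u v z).eq_or_lt with e0 | e0
  · simp [← e0]
  · obtain ⟨h1, h2, h3, h4, h5⟩ := h.pos e0
    have hb' : (1:ℝ) ≤ d := by exact_mod_cast hd
    have hm : 0 < mval pU q T 1 d u v z := h3.trans_le (h.le_mval one_pos hd u v z)
    apply mul_le_mul_of_nonneg_left _ e0.le
    rw [← Real.logb_div hm.ne' (by positivity)]
    apply Real.logb_le_logb_of_le (by norm_num) (by positivity)
    rw [div_le_iff₀ (by positivity)]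
    have : (1 + T u v z / TU q T u z / d) *
        (d * TU q T u z) = d * TU q T u z + T u v z := by
      field_simp
    rw [this]
    unfold mval
    simp only [Nat.cast_one, sub_self, zero_mul, add_zero]
    nlinarith

variable [Nonempty I] [Nonempty J]

lemma Sys.cb_errE (h : Sys pU q T) :
    ∑ c : I → U × (J → V), cbP pU q c * (((Fintype.card I : ℝ) * Fintype.card J)⁻¹ *
      ∑ i, ∑ j, ∑ z, T (c i).1 ((c i).2 j) z *
        (1 - T (c i).1 ((c i).2 j) z / ∑ i', ∑ j', T (c i').1 ((c i').2 j') z)) ≤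
      bndE pU q T (Fintype.card I) (Fintype.card J) := by
  have e0 : ∀ F : (I → U × (J → V)) → I → J → Z → ℝ, ∀ w : ℝ,
      ∑ c : I → U × (J → V), cbP pU q c * (w * ∑ i, ∑ j, ∑ z, F c i j z) =
      w * ∑ i, ∑ j, ∑ z, ∑ c : I → U × (J → V), cbP pU q c * F c i j z := by
    intro F w
    simp_rw [mul_left_comm _ w]
    rw [← Finset.mul_sum]
    congr 1
    simp_rw [Finset.mul_sum]
    rw [Finset.sum_comm]
    refine Finset.sum_congr rfl fun i _ => ?_
    rw [Finset.sum_comm]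
    refine Finset.sum_congr rfl fun j _ => ?_
    rw [Finset.sum_comm]
  rw [e0]
  have cI : (0:ℝ) < Fintype.card I := by exact_mod_cast Fintype.card_pos
  have cJ : (0:ℝ) < Fintype.card J := by exact_mod_cast Fintype.card_pos
  rw [inv_mul_le_iff₀ (by positivity)]
  calc _ ≤ ∑ i : I, ∑ j : J, bndE pU q T (Fintype.card I) (Fintype.card J) := by
        refine Finset.sum_le_sum fun i _ => Finset.sum_le_sum fun j _ => ?_
        calc _ ≤ ∑ z, ∑ u, ∑ v, pU u * q u v * T u v z *
              (1 - T u v z / mval pU q T (Fintype.card I) (Fintype.card J) u v z) :=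
              Finset.sum_le_sum fun z _ =>
                h.cb_err Finset.univ Finset.univ (Finset.mem_univ i) (Finset.mem_univ j) z
          _ = _ := by
              unfold bndE
              rw [Finset.sum_comm]
              exact Finset.sum_congr rfl fun u _ => Finset.sum_comm
    _ = _ := by
        simp only [Finset.sum_const, nsmul_eq_mul, mul_assoc, Finset.card_univ]

end oneshot

section leaks
variable {U V Z A B M D E : Type*} [Fintype U] [Fintype V] [Fintype Z]
  [Fintype A] [Fintype B] [Fintype M] [Fintype D] [Fintype E]
  [DecidableEq A] [DecidableEq B] [DecidableEq M] [DecidableEq D] [DecidableEq E]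
  [Nonempty A] [Nonempty B] [Nonempty M] [Nonempty D] [Nonempty E]
variable {pU : U → ℝ} {q : U → V → ℝ} {T : U → V → Z → ℝ}

/-- joint law of all messages and the output -/
def jnt2 (T : U → V → Z → ℝ) (c : A × B → U × (M × D × E → V))
    (s : (M × A × D) × Z) : ℝ :=
  ((Fintype.card M : ℝ) * Fintype.card A * Fintype.card D * (Fintype.card B * Fintype.card E))⁻¹ *
    ∑ b : B, ∑ e : E, T (c (s.1.2.1, b)).1 ((c (s.1.2.1, b)).2 (s.1.1, s.1.2.2, e)) s.2

/-- joint law of the first message and the output -/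
def jnt1 (T : U → V → Z → ℝ) (c : A × B → U × (M × D × E → V)) (s : M × Z) : ℝ :=
  ∑ i : A × B, ((Fintype.card (A × B) : ℝ) * Fintype.card M * (Fintype.card D * Fintype.card E))⁻¹ *
    ∑ d : D, ∑ e : E, T (c i).1 ((c i).2 (s.1, d, e)) s.2

lemma Sys.leak2 (h : Sys pU q T) :
    ∑ c : A × B → U × (M × D × E → V), cbP pU q c * mutInfo (jnt2 T c) ≤
      bnd2 pU q T (Fintype.card B) (Fintype.card E) := by
  have hP := cb_pmf (I := A × B) (J := M × D × E) h.pU h.q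
  have cA : (0:ℝ) < Fintype.card A := by exact_mod_cast Fintype.card_pos
  have cB : (0:ℝ) < Fintype.card B := by exact_mod_cast Fintype.card_pos
  have cM : (0:ℝ) < Fintype.card M := by exact_mod_cast Fintype.card_pos
  have cD : (0:ℝ) < Fintype.card D := by exact_mod_cast Fintype.card_pos
  have cE : (0:ℝ) < Fintype.card E := by exact_mod_cast Fintype.card_pos
  set K : ℝ := (Fintype.card M : ℝ) * Fintype.card A * Fintype.card D with hK
  set N : ℝ := (Fintype.card B : ℝ) * Fintype.card E with hN
  have K0 : 0 < K := by positivity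
  have N0 : 0 < N := by positivity
  let I' : M × A × D → Finset (A × B) := fun m => {m.2.1} ×ˢ Finset.univ
  let J' : M × A × D → Finset (M × D × E) := fun m => {m.1} ×ˢ ({m.2.2} ×ˢ Finset.univ)
  have cI' : ∀ m, (I' m).card = Fintype.card B := fun m => by simp [I']
  have cJ' : ∀ m, (J' m).card = Fintype.card E := fun m => by simp [J']
  have sumIJ : ∀ (m : M × A × D) (F : A × B → M × D × E → ℝ),
      ∑ i ∈ I' m, ∑ j ∈ J' m, F i j = ∑ b, ∑ e, F (m.2.1, b) (m.1, m.2.2, e) := by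
    intro m F
    simp [I', J']
  have step : ∀ c : A × B → U × (M × D × E → V), cbP pU q c * mutInfo (jnt2 T c) ≤
      cbP pU q c * ∑ m : M × A × D, ∑ z, (K * N)⁻¹ * ∑ i ∈ I' m, ∑ j ∈ J' m,
        T (c i).1 ((c i).2 j) z *
        (Real.logb 2 (∑ i' ∈ I' m, ∑ j' ∈ J' m, T (c i').1 ((c i').2 j') z) -
          Real.logb 2 (N * TQ pU q T z)) := by
    intro c
    rcases (hP.1 c).eq_or_lt with e0 | e0
    · simp [← e0]
    apply mul_le_mul_of_nonneg_left _ e0.le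
    have hTQ : ∀ i j z, 0 < T (c i).1 ((c i).2 j) z → 0 < TQ pU q T z := by
      intro i j z ht
      obtain ⟨h1, h2⟩ := cb_pos h.pU h.q e0 i j
      exact (h.pos (by positivity : 0 < pU (c i).1 * q (c i).1 ((c i).2 j) *
        T (c i).1 ((c i).2 j) z)).2.2.2.2
    let a : Unit → M × A × D → Z → ℝ := fun _ m z => (K * N)⁻¹ *
      ∑ i ∈ I' m, ∑ j ∈ J' m, T (c i).1 ((c i).2 j) z
    have az : ∀ m, ∑ z, a () m z = K⁻¹ := by
      intro m
      simp only [a]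
      rw [← Finset.mul_sum, Finset.sum_comm]
      rw [Finset.sum_congr rfl (fun i _ => Finset.sum_comm)]
      simp only [(h.T _ _).2, Finset.sum_const, nsmul_eq_mul, cI', cJ', mul_one]
      rw [← hN]; field_simp
    have L := leak_le a (fun _ z => TQ pU q T z)
      (fun _ m z => mul_nonneg (by positivity) (Finset.sum_nonneg fun i _ =>
        Finset.sum_nonneg fun j _ => (h.T _ _).1 z))
      (by
        simp only [Finset.univ_unique, Finset.sum_singleton]
        have : ∀ m, ∑ z, a default m z = K⁻¹ := az
        simp only [this, Finset.sum_const, nsmul_eq_mul, Finset.card_univ, Fintype.card_prod]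
        push_cast
        rw [← mul_assoc, ← hK, mul_inv_cancel₀ K0.ne'])
      (fun _ z => h.TQ_pmf.1 z)
      (by simp [h.TQ_pmf.2])
      (by
        intro _ m z h0
        simp only [a]
        rw [Finset.sum_eq_zero, mul_zero]
        intro i _
        apply Finset.sum_eq_zero
        intro j _
        by_contra hne
        have := hTQ i j z (((h.T _ _).1 z).lt_of_ne' hne)
        exact this.ne' h0)
    have e2 : jnt2 T c = fun s : (M × A × D) × Z => ∑ i, a i s.1 s.2 := by
      funext s
      simp only [Finset.univ_unique, Finset.sum_singleton, a, jnt2]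
      rw [sumIJ s.1 (fun i j => T (c i).1 ((c i).2 j) s.2)]
    rw [e2]
    refine L.trans (le_of_eq ?_)
    simp only [Finset.univ_unique, Finset.sum_singleton]
    refine Finset.sum_congr rfl fun m _ => Finset.sum_congr rfl fun z _ => ?_
    rw [← sum_mul_log_split (I' m) (J' m) (fun i j => T (c i).1 ((c i).2 j) z)
      (fun _ => N * TQ pU q T z) (fun i j => (h.T _ _).1 z)
      (fun i j ht => mul_pos N0 (hTQ i j z ht))]
    have : ∀ m, ∑ z, a default m z = K⁻¹ := az
    rw [this]
    simp only [a]
    simp only [← Finset.sum_mul, mul_assoc]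
    congr 3
    by_cases hq0 : TQ pU q T z = 0
    · simp [hq0]
    · field_simp
  refine (Finset.sum_le_sum fun c _ => step c).trans ?_
  have e0 : ∀ F : (A × B → U × (M × D × E → V)) → M × A × D → Z → ℝ,
      ∑ c : A × B → U × (M × D × E → V), cbP pU q c * ∑ m, ∑ z, (K * N)⁻¹ * F c m z =
      ∑ m, ∑ z, (K * N)⁻¹ * ∑ c : A × B → U × (M × D × E → V), cbP pU q c * F c m z := by
    intro F
    simp_rw [Finset.mul_sum]
    rw [Finset.sum_comm]
    refine Finset.sum_congr rfl fun i _ => ?_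
    rw [Finset.sum_comm]
    refine Finset.sum_congr rfl fun j _ => ?_
    refine Finset.sum_congr rfl fun c _ => ?_
    ring
  rw [e0]
  calc _ ≤ ∑ m : M × A × D, ∑ z, (K * N)⁻¹ * (N * ∑ u, ∑ v, pU u * q u v * T u v z *
          (Real.logb 2 (1 + TU q T u z / TQ pU q T z / (Fintype.card B)) +
            Real.logb 2 (1 + T u v z / TQ pU q T z / (Fintype.card B * Fintype.card E)))) := by
        refine Finset.sum_le_sum fun m _ => Finset.sum_le_sum fun z _ => ?_
        apply mul_le_mul_of_nonneg_left _ (by positivity)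
        refine (h.cb_div (I' m) (J' m) N (fun _ => TQ pU q T z) z).trans ?_
        rw [cI', cJ']
        apply mul_le_mul_of_nonneg_left _ (by positivity)
        exact Finset.sum_le_sum fun u _ => Finset.sum_le_sum fun v _ =>
          h.le_bnd2 Fintype.card_pos Fintype.card_pos u v z
    _ = ∑ m : M × A × D, K⁻¹ * bnd2 pU q T (Fintype.card B) (Fintype.card E) := by
        refine Finset.sum_congr rfl fun m _ => ?_
        unfold bnd2
        rw [← Finset.mul_sum, ← Finset.mul_sum, Finset.sum_comm,
          Finset.sum_congr rfl (fun u _ => Finset.sum_comm), ← mul_assoc]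
        congr 1
        field_simp
    _ = _ := by
        simp only [Finset.sum_const, nsmul_eq_mul, Finset.card_univ, Fintype.card_prod]
        push_cast
        rw [← mul_assoc, ← mul_assoc (Fintype.card M : ℝ), ← hK, mul_inv_cancel₀ K0.ne', one_mul]

lemma Sys.leak1 (h : Sys pU q T) :
    ∑ c : A × B → U × (M × D × E → V), cbP pU q c * mutInfo (jnt1 T c) ≤
      bnd1 pU q T (Fintype.card D * Fintype.card E) := by
  have hP := cb_pmf (I := A × B) (J := M × D × E) h.pU h.q
  have cI : (0:ℝ) < Fintype.card (A × B) := by exact_mod_cast Fintype.card_pos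
  have cM : (0:ℝ) < Fintype.card M := by exact_mod_cast Fintype.card_pos
  have cD : (0:ℝ) < Fintype.card D := by exact_mod_cast Fintype.card_pos
  have cE : (0:ℝ) < Fintype.card E := by exact_mod_cast Fintype.card_pos
  set cc : ℝ := (Fintype.card (A × B) : ℝ) with hcc
  set K : ℝ := (Fintype.card M : ℝ) with hK
  set N : ℝ := (Fintype.card D : ℝ) * Fintype.card E with hN
  have N0 : 0 < N := by positivity
  let J' : M → Finset (M × D × E) := fun m => {m} ×ˢ (Finset.univ ×ˢ Finset.univ)
  have cJ' : ∀ m, (J' m).card = Fintype.card D * Fintype.card E := fun m => by simp [J']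
  have cJr : ∀ m, ((J' m).card : ℝ) = N := fun m => by rw [cJ']; push_cast; rfl
  have sumIJ : ∀ (i : A × B) (m : M) (F : A × B → M × D × E → ℝ),
      ∑ i ∈ ({i} : Finset (A × B)), ∑ j ∈ J' m, F i j = ∑ d, ∑ e, F i (m, d, e) := by
    intro i m F
    rw [Finset.sum_singleton]
    simp only [J']
    rw [Finset.sum_product, Finset.sum_singleton, Finset.sum_product]
  have step : ∀ c : A × B → U × (M × D × E → V), cbP pU q c * mutInfo (jnt1 T c) ≤
      cbP pU q c * ∑ i : A × B, ∑ m : M, ∑ z, (cc * K * N)⁻¹ *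
        ∑ k ∈ ({i} : Finset (A × B)), ∑ j ∈ J' m,
        T (c k).1 ((c k).2 j) z *
        (Real.logb 2 (∑ i' ∈ ({i} : Finset (A × B)), ∑ j' ∈ J' m, T (c i').1 ((c i').2 j') z) -
          Real.logb 2 (N * TU q T (c k).1 z)) := by
    intro c
    rcases (hP.1 c).eq_or_lt with e0 | e0
    · simp [← e0]
    apply mul_le_mul_of_nonneg_left _ e0.le
    have hTU : ∀ i j z, 0 < T (c i).1 ((c i).2 j) z → 0 < TU q T (c i).1 z := by
      intro i j z ht
      obtain ⟨h1, h2⟩ := cb_pos h.pU h.q e0 i j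
      exact (h.pos (by positivity : 0 < pU (c i).1 * q (c i).1 ((c i).2 j) *
        T (c i).1 ((c i).2 j) z)).2.2.2.1
    let a : A × B → M → Z → ℝ := fun i m z => (cc * K * N)⁻¹ *
      ∑ d : D, ∑ e : E, T (c i).1 ((c i).2 (m, d, e)) z
    have az : ∀ i m, ∑ z, a i m z = (cc * K)⁻¹ := by
      intro i m
      simp only [a]
      rw [← Finset.mul_sum, Finset.sum_comm]
      rw [Finset.sum_congr rfl (fun i _ => Finset.sum_comm)]
      simp only [(h.T _ _).2, Finset.sum_const, nsmul_eq_mul, mul_one, Finset.card_univ]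
      rw [← hN]; field_simp
    have L := leak_le a (fun i z => cc⁻¹ * TU q T (c i).1 z)
      (fun _ m z => mul_nonneg (by positivity) (Finset.sum_nonneg fun i _ =>
        Finset.sum_nonneg fun j _ => (h.T _ _).1 z))
      (by
        simp only [az, Finset.sum_const, nsmul_eq_mul, Finset.card_univ]
        rw [← hcc, ← hK]
        field_simp)
      (fun i z => mul_nonneg (by positivity) ((h.TU_chan _).1 z))
      (by
        simp_rw [← Finset.mul_sum, (h.TU_chan _).2]
        simp only [mul_one, Finset.sum_const, nsmul_eq_mul, Finset.card_univ]
        rw [← hcc, inv_mul_cancel₀ cI.ne'])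
      (by
        intro i m z h0
        have h0' : TU q T (c i).1 z = 0 := by
          rcases mul_eq_zero.1 h0 with h0 | h0
          · exact absurd h0 (by positivity)
          · exact h0
        simp only [a]
        rw [Finset.sum_eq_zero, mul_zero]
        intro d _
        apply Finset.sum_eq_zero
        intro e _
        by_contra hne
        have := hTU i (m, d, e) z (((h.T _ _).1 z).lt_of_ne' hne)
        exact this.ne' h0')
    have e2 : jnt1 T c = fun s : M × Z => ∑ i, a i s.1 s.2 := by
      funext s
      simp only [a, jnt1]
      rfl
    rw [e2]
    refine L.trans (le_of_eq ?_)
    refine Finset.sum_congr rfl fun i _ => Finset.sum_congr rfl fun m _ =>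
      Finset.sum_congr rfl fun z _ => ?_
    rw [← sum_mul_log_split {i} (J' m) (fun i j => T (c i).1 ((c i).2 j) z)
      (fun i => N * TU q T (c i).1 z) (fun i j => (h.T _ _).1 z)
      (fun i j ht => mul_pos N0 (hTU i j z ht))]
    rw [Finset.sum_comm, Finset.sum_congr rfl (fun i' _ => az i' m)]
    rw [sumIJ i m (fun i j => T (c i).1 ((c i).2 j) z)]
    rw [sumIJ i m (fun i' j => T (c i').1 ((c i').2 j) z * Real.logb 2
      ((∑ d, ∑ e, T (c i).1 ((c i).2 (m, d, e)) z) / (N * TU q T (c i').1 z)))]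
    simp only [a, Finset.sum_const, nsmul_eq_mul, Finset.card_univ]
    rw [← hcc]
    simp only [← Finset.sum_mul, mul_assoc]
    congr 3
    by_cases hq0 : TU q T (c i).1 z = 0
    · simp [hq0]
    · field_simp
  refine (Finset.sum_le_sum fun c _ => step c).trans ?_
  have e0 : ∀ F : (A × B → U × (M × D × E → V)) → A × B → M → Z → ℝ, ∀ w : ℝ,
      ∑ c : A × B → U × (M × D × E → V), cbP pU q c * ∑ i, ∑ m, ∑ z, w * F c i m z =
      ∑ i, ∑ m, ∑ z, w * ∑ c : A × B → U × (M × D × E → V), cbP pU q c * F c i m z := by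
    intro F w
    simp_rw [Finset.mul_sum]
    rw [Finset.sum_comm]
    refine Finset.sum_congr rfl fun i _ => ?_
    rw [Finset.sum_comm]
    refine Finset.sum_congr rfl fun m _ => ?_
    rw [Finset.sum_comm]
    refine Finset.sum_congr rfl fun j _ => ?_
    refine Finset.sum_congr rfl fun c _ => ?_
    ring
  rw [e0]
  calc _ ≤ ∑ i : A × B, ∑ m : M, ∑ z, (cc * K * N)⁻¹ * (N * ∑ u, ∑ v, pU u * q u v * T u v z *
          Real.logb 2 (1 + T u v z / TU q T u z / (Fintype.card D * Fintype.card E : ℕ))) := by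
        refine Finset.sum_le_sum fun i _ => Finset.sum_le_sum fun m _ =>
          Finset.sum_le_sum fun z _ => ?_
        apply mul_le_mul_of_nonneg_left _ (by positivity)
        refine (h.cb_div {i} (J' m) N (fun u => TU q T u z) z).trans ?_
        rw [cJr, Finset.card_singleton, Nat.cast_one, one_mul]
        apply mul_le_mul_of_nonneg_left _ (by positivity)
        refine Finset.sum_le_sum fun u _ => Finset.sum_le_sum fun v _ => ?_
        have := h.le_bnd1 (d := Fintype.card D * Fintype.card E)
          (Nat.mul_pos Fintype.card_pos Fintype.card_pos) u v z
        rw [cJ']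
        refine le_trans (le_of_eq ?_) this
        rw [hN]; push_cast; rfl
    _ = ∑ i : A × B, ∑ m : M, (cc * K)⁻¹ * bnd1 pU q T (Fintype.card D * Fintype.card E) := by
        refine Finset.sum_congr rfl fun i _ => Finset.sum_congr rfl fun m _ => ?_
        unfold bnd1
        rw [← Finset.mul_sum, ← Finset.mul_sum, Finset.sum_comm,
          Finset.sum_congr rfl (fun u _ => Finset.sum_comm), ← mul_assoc]
        congr 1
        field_simp
    _ = _ := by
        simp only [Finset.sum_const, nsmul_eq_mul, Finset.card_univ]
        rw [← hcc, ← hK]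
        field_simp

end leaks
end

section


lemma chernoff {α : Type*} [Fintype α] {g : α → ℝ} (hg : IsPMF g) (f : α → ℝ)
    (hf : ∑ a, g a * f a < 0) :
    ∃ s : ℝ, 0 < s ∧ s ≤ 1 ∧ ∑ a, g a * (2:ℝ) ^ (s * f a) < 1 := by
  have hd : HasDerivAt (fun s : ℝ => ∑ a, g a * (2:ℝ) ^ (s * f a))
      (∑ a, g a * ((2:ℝ) ^ (0 * f a) * Real.log 2 * f a)) 0 := by
    apply HasDerivAt.fun_sum
    intro a _
    apply HasDerivAt.const_mul
    have h1 : HasDerivAt (fun s : ℝ => s * f a) (f a) 0 := by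
      simpa using (hasDerivAt_id (0:ℝ)).mul_const (f a)
    have := h1.const_rpow (a := 2) (by norm_num)
    have e : (2:ℝ) ^ (0 * f a) * Real.log 2 * f a = Real.log 2 * f a * (2:ℝ) ^ (0 * f a) := by
      simp only [zero_mul, Real.rpow_zero]; ring
    rw [e]
    exact this
  have hneg : ∑ a, g a * ((2:ℝ) ^ (0 * f a) * Real.log 2 * f a) < 0 := by
    have : ∑ a, g a * ((2:ℝ) ^ (0 * f a) * Real.log 2 * f a) = Real.log 2 * ∑ a, g a * f a := by
      rw [Finset.mul_sum]
      refine Finset.sum_congr rfl fun a _ => ?_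
      simp; ring
    rw [this]
    exact mul_neg_of_pos_of_neg (Real.log_pos (by norm_num)) hf
  have h0 : ∑ a, g a * (2:ℝ) ^ ((0:ℝ) * f a) = 1 := by simp [hg.2]
  have hev := hd.tendsto_slope_zero_right.eventually (gt_mem_nhds hneg)
  have hev2 : ∀ᶠ s : ℝ in nhdsWithin 0 (Set.Ioi 0), s ≤ 1 :=
    (Filter.Eventually.filter_mono nhdsWithin_le_nhds (ge_mem_nhds (by norm_num)))
  obtain ⟨s, ⟨h1, h2⟩, h3⟩ := ((hev.and hev2).and self_mem_nhdsWithin).exists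
  refine ⟨s, h3, h2, ?_⟩
  have hs : (0:ℝ) < s := h3
  simp only [zero_add, smul_eq_mul] at h1
  rw [h0] at h1
  have := (inv_mul_lt_iff₀ hs).1 h1
  linarith

lemma iid_exp {α : Type*} [Fintype α] (g f : α → ℝ) (s : ℝ) (n : ℕ) :
    ∑ a : Fin n → α, (∏ i, g (a i)) * (2:ℝ) ^ (s * ∑ i, f (a i)) =
      (∑ x, g x * (2:ℝ) ^ (s * f x)) ^ n := by
  have : ∀ a : Fin n → α, (∏ i, g (a i)) * (2:ℝ) ^ (s * ∑ i, f (a i)) =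
      ∏ i, (g (a i) * (2:ℝ) ^ (s * f (a i))) := by
    intro a
    rw [Finset.prod_mul_distrib, Finset.mul_sum, Real.rpow_sum_of_pos (by norm_num)]
  simp_rw [this]
  rw [sum_prod_pi (fun _ x => g x * (2:ℝ) ^ (s * f x))]
  simp

lemma prod_eq_rpow {α : Type*} [Fintype α] {g ρ : α → ℝ} (hg : ∀ a, 0 ≤ g a)
    (hρ : ∀ a, 0 < g a → 0 < ρ a) {n : ℕ}
    {a : Fin n → α} (ha : 0 < ∏ i, g (a i)) :
    ∏ i, ρ (a i) = (2:ℝ) ^ (∑ i, Real.logb 2 (ρ (a i))) := by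
  rw [Real.rpow_sum_of_pos (by norm_num)]
  refine Finset.prod_congr rfl fun i _ => ?_
  have : 0 < g (a i) := (hg _).lt_of_ne' fun e =>
    ha.ne' (Finset.prod_eq_zero (Finset.mem_univ i) e)
  rw [Real.rpow_logb (by norm_num) (by norm_num) (hρ _ this)]

lemma log_one_add_le {s t : ℝ} (hs : 0 < s) (hs1 : s ≤ 1) (ht : 0 < t) :
    Real.logb 2 (1 + t) ≤ t ^ s / (s * Real.log 2) := by
  have l2 : 0 < Real.log 2 := Real.log_pos (by norm_num)
  have h1 : (1 + t) ^ s ≤ 1 + t ^ s := by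
    have := Real.rpow_add_le_add_rpow (a := 1) (b := t) (p := s) (by norm_num) ht.le hs.le hs1
    simpa using this
  have h2 : s * Real.log (1 + t) ≤ t ^ s := by
    rw [← Real.log_rpow (by linarith)]
    have p : 0 < t ^ s := Real.rpow_pos_of_pos ht s
    have := Real.log_le_sub_one_of_pos (x := 1 + t ^ s) (by linarith)
    have h3 := Real.log_le_log (Real.rpow_pos_of_pos (by linarith) s) h1
    linarith
  unfold Real.logb
  rw [div_le_div_iff₀ l2 (by positivity)]
  nlinarith

lemma leak_bound {α : Type*} [Fintype α] {g ρ : α → ℝ} (hg : IsPMF g)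
    (hρ : ∀ a, 0 < g a → 0 < ρ a) {δ : ℝ} (hδ : 0 < δ) :
    ∃ N0 : ℕ, ∀ n ≥ N0, ∀ K : ℝ,
      (2:ℝ) ^ ((n:ℝ) * ((∑ a, g a * Real.logb 2 (ρ a)) - δ)) ≤ K →
      ∑ a : Fin n → α, (∏ i, g (a i)) * Real.logb 2 (1 + (∏ i, ρ (a i)) / K) ≤ 3 * n * δ := by
  have l2 : 0 < Real.log 2 := Real.log_pos (by norm_num)
  set I := ∑ a, g a * Real.logb 2 (ρ a) with hI
  obtain ⟨s, s0, s1, hs⟩ := chernoff hg (fun a => Real.logb 2 (ρ a) - I - δ) (by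
    simp only [mul_sub, Finset.sum_sub_distrib, ← Finset.sum_mul, hg.2]
    linarith)
  set γ := ∑ a, g a * (2:ℝ) ^ (s * (Real.logb 2 (ρ a) - I - δ)) with hγ
  have γ0 : 0 ≤ γ := Finset.sum_nonneg fun a _ => mul_nonneg (hg.1 a) (by positivity)
  obtain ⟨N0, hN0⟩ := exists_nat_ge (1 / (s * Real.log 2) / δ)
  refine ⟨N0, fun n hn K hK => ?_⟩
  have hP := pi_pmf (ι := Fin n) hg
  have K0 : 0 < K := lt_of_lt_of_le (by positivity) hK
  calc _ ≤ ∑ a : Fin n → α, ((∏ i, g (a i)) * (2 * n * δ) + (∏ i, g (a i)) *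
        (2:ℝ) ^ (s * ∑ i, (Real.logb 2 (ρ (a i)) - I - δ)) * (1 / (s * Real.log 2))) := by
        refine Finset.sum_le_sum fun a _ => ?_
        rw [mul_assoc (∏ i, g (a i)) ((2:ℝ) ^ _) _, ← mul_add]
        rcases (hP.1 a).eq_or_lt with e | e
        · simp only at e; rw [← e]; simp
        apply mul_le_mul_of_nonneg_left _ e.le
        rw [prod_eq_rpow hg.1 hρ e]
        set L := ∑ i, Real.logb 2 (ρ (a i)) with hL
        have e1 : ∑ i, (Real.logb 2 (ρ (a i)) - I - δ) = L - n * (I + δ) := by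
          simp only [Finset.sum_sub_distrib, Finset.sum_const, Finset.card_univ, Fintype.card_fin,
            nsmul_eq_mul]
          ring
        rw [e1]
        set t : ℝ := (2:ℝ) ^ (L - n * (I + δ)) with ht
        have t0 : 0 < t := by positivity
        have h1 : (2:ℝ) ^ L / K ≤ (2:ℝ) ^ (2 * n * δ) * t := by
          rw [div_le_iff₀ K0, ht, ← Real.rpow_add (by norm_num)]
          calc (2:ℝ) ^ L = (2:ℝ) ^ (2 * n * δ + (L - n * (I + δ))) * 2 ^ ((n:ℝ) * (I - δ)) := by
                rw [← Real.rpow_add (by norm_num)]; congr 1; ring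
            _ ≤ _ := mul_le_mul_of_nonneg_left hK (by positivity)
        have h2 : (1:ℝ) ≤ (2:ℝ) ^ (2 * n * δ) := Real.one_le_rpow (by norm_num) (by positivity)
        have h3 : 1 + (2:ℝ) ^ L / K ≤ (2:ℝ) ^ (2 * n * δ) * (1 + t) := by nlinarith
        have h4 := Real.logb_le_logb_of_le (b := 2) (by norm_num) (by positivity) h3
        rw [Real.logb_mul (by positivity) (by positivity),
          Real.logb_rpow (by norm_num) (by norm_num)] at h4
        have h5 := log_one_add_le s0 s1 t0
        rw [ht, ← Real.rpow_mul (by norm_num), ← ht] at h5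
        rw [mul_one_div, mul_comm s]
        linarith
    _ = 2 * n * δ + γ ^ n * (1 / (s * Real.log 2)) := by
        rw [Finset.sum_add_distrib, ← Finset.sum_mul, ← Finset.sum_mul, hP.2, iid_exp g
          (fun a => Real.logb 2 (ρ a) - I - δ), one_mul]
    _ ≤ 3 * n * δ := by
        have h1 : γ ^ n ≤ 1 := pow_le_one₀ γ0 hs.le
        have h2 : 1 / (s * Real.log 2) ≤ n * δ := by
          rw [← div_le_iff₀ hδ]
          exact hN0.trans (by exact_mod_cast hn)
        have h3 : 0 < 1 / (s * Real.log 2) := by positivity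
        nlinarith

lemma err_bound {α : Type*} [Fintype α] {g ρ : α → ℝ} (hg : IsPMF g)
    (hρ : ∀ a, 0 < g a → 0 < ρ a) {δ : ℝ} (hδ : 0 < δ) {C η : ℝ} (hC : 1 ≤ C) (hη : 0 < η) :
    ∃ N0 : ℕ, ∀ n ≥ N0, ∀ K : ℝ, 0 ≤ K →
      K ≤ C * (2:ℝ) ^ ((n:ℝ) * ((∑ a, g a * Real.logb 2 (ρ a)) - δ)) →
      ∑ a : Fin n → α, (∏ i, g (a i)) * min 1 (K * (∏ i, ρ (a i))⁻¹) ≤ η := by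
  set I := ∑ a, g a * Real.logb 2 (ρ a) with hI
  obtain ⟨s, s0, s1, hs⟩ := chernoff hg (fun a => I - δ - Real.logb 2 (ρ a)) (by
    simp only [mul_sub, Finset.sum_sub_distrib, ← Finset.sum_mul, hg.2]
    linarith)
  set γ := ∑ a, g a * (2:ℝ) ^ (s * (I - δ - Real.logb 2 (ρ a))) with hγ
  have γ0 : 0 ≤ γ := Finset.sum_nonneg fun a _ => mul_nonneg (hg.1 a) (by positivity)
  have C0 : 0 < C := by linarith
  have lim := tendsto_pow_atTop_nhds_zero_of_lt_one γ0 hs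
  obtain ⟨N0, hN0⟩ := Filter.eventually_atTop.1 (lim.eventually (gt_mem_nhds (div_pos hη C0)))
  refine ⟨N0, fun n hn K hK0 hK => ?_⟩
  have hP := pi_pmf (ι := Fin n) hg
  calc _ ≤ ∑ a : Fin n → α, C * ((∏ i, g (a i)) *
        (2:ℝ) ^ (s * ∑ i, (I - δ - Real.logb 2 (ρ (a i))))) := by
        refine Finset.sum_le_sum fun a _ => ?_
        rw [mul_left_comm]
        rcases (hP.1 a).eq_or_lt with e | e
        · simp only at e; rw [← e]; simp
        apply mul_le_mul_of_nonneg_left _ e.le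
        rw [prod_eq_rpow hg.1 hρ e]
        set L := ∑ i, Real.logb 2 (ρ (a i)) with hL
        have e1 : ∑ i, (I - δ - Real.logb 2 (ρ (a i))) = n * (I - δ) - L := by
          simp only [Finset.sum_sub_distrib, Finset.sum_const, Finset.card_univ, Fintype.card_fin,
            nsmul_eq_mul]
          ring
        rw [e1, ← Real.rpow_neg (by norm_num)]
        set x : ℝ := (2:ℝ) ^ (n * (I - δ) - L) with hx
        have x0 : 0 < x := by positivity
        have h1 : K * (2:ℝ) ^ (-L) ≤ C * x := by
          calc _ ≤ C * (2:ℝ) ^ ((n:ℝ) * (I - δ)) * (2:ℝ) ^ (-L) :=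
                mul_le_mul_of_nonneg_right hK (by positivity)
            _ = _ := by
                rw [mul_assoc, ← Real.rpow_add (by norm_num), hx]; congr 2
        have h2 : (2:ℝ) ^ (s * (n * (I - δ) - L)) = x ^ s := by
          rw [hx, ← Real.rpow_mul (by norm_num), mul_comm]
        rw [h2]
        by_cases hx1 : x ≤ 1
        · have : x ≤ x ^ s := by
            conv_lhs => rw [← Real.rpow_one x]
            exact Real.rpow_le_rpow_of_exponent_ge x0 hx1 s1
          calc _ ≤ K * (2:ℝ) ^ (-L) := min_le_right _ _
            _ ≤ C * x := h1
            _ ≤ _ := mul_le_mul_of_nonneg_left this C0.le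
        · have : 1 ≤ x ^ s := Real.one_le_rpow (not_le.1 hx1).le s0.le
          calc _ ≤ (1:ℝ) := min_le_left _ _
            _ ≤ _ := by nlinarith
    _ = C * γ ^ n := by
        rw [← Finset.mul_sum, iid_exp g (fun a => I - δ - Real.logb 2 (ρ a))]
    _ ≤ η := by
        have := (hN0 n hn).le
        rw [le_div_iff₀ C0] at this
        linarith

section nfold
variable {U V Z : Type*} [Fintype U] [Fintype V] [Fintype Z]

/-- i.i.d. extension of a pmf -/
def pn (n : ℕ) (pU : U → ℝ) (us : Fin n → U) : ℝ := ∏ i, pU (us i)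
/-- memoryless extension of a channel -/
def qn (n : ℕ) (q : U → V → ℝ) (us : Fin n → U) (vs : Fin n → V) : ℝ := ∏ i, q (us i) (vs i)
/-- memoryless extension of a two-input channel -/
def Tn (n : ℕ) (T : U → V → Z → ℝ) (us : Fin n → U) (vs : Fin n → V) (zs : Fin n → Z) : ℝ :=
  ∏ i, T (us i) (vs i) (zs i)

variable {pU : U → ℝ} {q : U → V → ℝ} {T : U → V → Z → ℝ}

lemma chan_pi (n : ℕ) (f : Fin n → Z → ℝ) (hf : ∀ i, IsPMF (f i)) :
    IsPMF (fun zs : Fin n → Z => ∏ i, f i (zs i)) := by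
  refine ⟨fun zs => Finset.prod_nonneg fun i _ => (hf i).1 _, ?_⟩
  rw [sum_prod_pi]
  simp [(hf _).2]

lemma Sys.pow (h : Sys pU q T) (n : ℕ) : Sys (pn n pU) (qn n q) (Tn n T) :=
  ⟨chan_pi n _ fun _ => h.pU, fun us => chan_pi n _ fun i => h.q (us i),
    fun us vs => chan_pi n _ fun i => h.T (us i) (vs i)⟩

lemma TU_pow (n : ℕ) (us : Fin n → U) (zs : Fin n → Z) :
    TU (qn n q) (Tn n T) us zs = ∏ i, TU q T (us i) (zs i) := by
  unfold TU qn Tn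
  rw [← sum_prod_pi (fun i v => q (us i) v * T (us i) v (zs i))]
  simp_rw [Finset.prod_mul_distrib]

lemma TQ_pow (n : ℕ) (zs : Fin n → Z) :
    TQ (pn n pU) (qn n q) (Tn n T) zs = ∏ i, TQ pU q T (zs i) := by
  unfold TQ
  rw [← sum_prod_pi (fun i u => pU u * TU q T u (zs i))]
  simp_rw [Finset.prod_mul_distrib, TU_pow]
  rfl

lemma sum3 (n : ℕ) (F : (Fin n → U × V × Z) → ℝ) :
    ∑ us : Fin n → U, ∑ vs : Fin n → V, ∑ zs : Fin n → Z, F (fun i => (us i, vs i, zs i)) =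
      ∑ a : Fin n → U × V × Z, F a := by
  symm
  rw [← Equiv.sum_comp (Equiv.arrowProdEquivProdArrow (Fin n) (fun _ => U) (fun _ => V × Z)).symm,
    Fintype.sum_prod_type]
  refine Finset.sum_congr rfl fun us _ => ?_
  rw [← Equiv.sum_comp (Equiv.arrowProdEquivProdArrow (Fin n) (fun _ => V) (fun _ => Z)).symm,
    Fintype.sum_prod_type]
  rfl

/-- joint letter pmf -/
def gl (pU : U → ℝ) (q : U → V → ℝ) (T : U → V → Z → ℝ) (a : U × V × Z) : ℝ :=
  pU a.1 * q a.1 a.2.1 * T a.1 a.2.1 a.2.2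

lemma Sys.gl_pmf (h : Sys pU q T) : IsPMF (gl pU q T) := by
  refine ⟨fun a => h.nonneg _ _ _, ?_⟩
  simp only [Fintype.sum_prod_type]
  exact h.sum_one

lemma gl_prod (n : ℕ) (us : Fin n → U) (vs : Fin n → V) (zs : Fin n → Z) :
    pn n pU us * qn n q us vs * Tn n T us vs zs = ∏ i, gl pU q T (us i, vs i, zs i) := by
  unfold pn qn Tn gl
  simp_rw [Finset.prod_mul_distrib]

lemma Sys.bnd1_pow (h : Sys pU q T) {δ : ℝ} (hδ : 0 < δ) :
    ∃ N0 : ℕ, ∀ n ≥ N0, ∀ d : ℕ, (2:ℝ) ^ ((n:ℝ) * (infVU pU q T - δ)) ≤ d →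
      bnd1 (pn n pU) (qn n q) (Tn n T) d ≤ 3 * n * δ := by
  obtain ⟨N0, hN0⟩ := leak_bound (ρ := fun a : U × V × Z => T a.1 a.2.1 a.2.2 / TU q T a.1 a.2.2)
    h.gl_pmf (fun a ha => by
      obtain ⟨h1, h2, h3, h4, h5⟩ := h.pos ha
      exact div_pos h3 h4) hδ
  refine ⟨N0, fun n hn d hd => ?_⟩
  have e : ∑ a : U × V × Z, gl pU q T a * Real.logb 2 (T a.1 a.2.1 a.2.2 / TU q T a.1 a.2.2) =
      infVU pU q T := by
    simp only [Fintype.sum_prod_type]; rfl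
  rw [e] at hN0
  refine le_trans (le_of_eq ?_) (hN0 n hn d hd)
  rw [← sum3]
  unfold bnd1
  refine Finset.sum_congr rfl fun us _ => Finset.sum_congr rfl fun vs _ =>
    Finset.sum_congr rfl fun zs _ => ?_
  rw [gl_prod, TU_pow, Finset.prod_div_distrib]
  rfl

lemma Sys.bnd2_pow (h : Sys pU q T) {δ : ℝ} (hδ : 0 < δ) :
    ∃ N0 : ℕ, ∀ n ≥ N0, ∀ b e : ℕ, (2:ℝ) ^ ((n:ℝ) * (infU pU q T - δ)) ≤ b →
      (2:ℝ) ^ ((n:ℝ) * (infUV pU q T - δ)) ≤ b * e →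
      bnd2 (pn n pU) (qn n q) (Tn n T) b e ≤ 6 * n * δ := by
  obtain ⟨N0, hN0⟩ := leak_bound (ρ := fun a : U × V × Z => TU q T a.1 a.2.2 / TQ pU q T a.2.2)
    h.gl_pmf (fun a ha => by
      obtain ⟨h1, h2, h3, h4, h5⟩ := h.pos ha
      exact div_pos h4 h5) hδ
  obtain ⟨N1, hN1⟩ := leak_bound (ρ := fun a : U × V × Z => T a.1 a.2.1 a.2.2 / TQ pU q T a.2.2)
    h.gl_pmf (fun a ha => by
      obtain ⟨h1, h2, h3, h4, h5⟩ := h.pos ha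
      exact div_pos h3 h5) hδ
  refine ⟨max N0 N1, fun n hn b e hb he => ?_⟩
  have e0 : ∑ a : U × V × Z, gl pU q T a * Real.logb 2 (TU q T a.1 a.2.2 / TQ pU q T a.2.2) =
      infU pU q T := by
    simp only [Fintype.sum_prod_type]; rfl
  have e1 : ∑ a : U × V × Z, gl pU q T a * Real.logb 2 (T a.1 a.2.1 a.2.2 / TQ pU q T a.2.2) =
      infUV pU q T := by
    simp only [Fintype.sum_prod_type]; rfl
  rw [e0] at hN0
  rw [e1] at hN1
  have b0 := hN0 n (le_of_max_le_left hn) b hb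
  have b1 := hN1 n (le_of_max_le_right hn) (b * e) he
  have : bnd2 (pn n pU) (qn n q) (Tn n T) b e ≤ 3 * n * δ + 3 * n * δ := by
    refine le_trans (le_of_eq ?_) (add_le_add b0 b1)
    rw [← sum3, ← sum3]
    unfold bnd2
    simp only [← Finset.sum_add_distrib]
    refine Finset.sum_congr rfl fun us _ => Finset.sum_congr rfl fun vs _ =>
      Finset.sum_congr rfl fun zs _ => ?_
    rw [gl_prod, TU_pow, TQ_pow, Finset.prod_div_distrib, Finset.prod_div_distrib, mul_add]
    rfl
  linarith

lemma Sys.le_bndE (h : Sys pU q T) {a b : ℕ} (ha : 0 < a) (hb : 0 < b) (u v z) :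
    pU u * q u v * T u v z * (1 - T u v z / mval pU q T a b u v z) ≤
    pU u * q u v * T u v z * min 1 ((b - 1 : ℝ) * (T u v z / TU q T u z)⁻¹) +
    pU u * q u v * T u v z * min 1 ((a - 1 : ℝ) * b * (T u v z / TQ pU q T z)⁻¹) := by
  rw [← mul_add]
  rcases (h.nonneg u v z).eq_or_lt with e0 | e0
  · simp [← e0]
  · obtain ⟨h1, h2, h3, h4, h5⟩ := h.pos e0
    have ha' : (0:ℝ) ≤ a - 1 := by
      have : (1:ℝ) ≤ a := by exact_mod_cast ha
      linarith
    have hb' : (0:ℝ) ≤ b - 1 := by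
      have : (1:ℝ) ≤ b := by exact_mod_cast hb
      linarith
    have hm : 0 < mval pU q T a b u v z := h3.trans_le (h.le_mval ha hb u v z)
    apply mul_le_mul_of_nonneg_left _ e0.le
    set x := (b - 1 : ℝ) * (T u v z / TU q T u z)⁻¹ with hx
    set y := (a - 1 : ℝ) * b * (T u v z / TQ pU q T z)⁻¹ with hy
    have x0 : 0 ≤ x := by positivity
    have y0 : 0 ≤ y := by positivity
    have em : mval pU q T a b u v z = T u v z * (1 + x + y) := by
      unfold mval
      rw [hx, hy]
      field_simp
    have k0 : 0 < 1 + x + y := by positivity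
    have e2 : 1 - T u v z / mval pU q T a b u v z = (x + y) / (1 + x + y) := by
      rw [em]; field_simp; ring
    rw [e2]
    have l1 : (x + y) / (1 + x + y) ≤ 1 := by rw [div_le_one k0]; linarith
    have l2 : (x + y) / (1 + x + y) ≤ x + y := div_le_self (by positivity) (by linarith)
    rcases le_total 1 x with hx1 | hx1
    · rw [min_eq_left hx1]
      have : 0 ≤ min 1 y := le_min zero_le_one y0
      linarith
    · rw [min_eq_right hx1]
      rcases le_total 1 y with hy1 | hy1
      · rw [min_eq_left hy1]; linarith
      · rw [min_eq_right hy1]; linarith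

lemma Sys.bndE_pow (h : Sys pU q T) {δ C η : ℝ} (hδ : 0 < δ) (hC : 1 ≤ C) (hη : 0 < η) :
    ∃ N0 : ℕ, ∀ n ≥ N0, ∀ a b : ℕ, 0 < a → 0 < b →
      (b - 1 : ℝ) ≤ C * (2:ℝ) ^ ((n:ℝ) * (infVU pU q T - δ)) →
      (a - 1 : ℝ) * b ≤ C * (2:ℝ) ^ ((n:ℝ) * (infUV pU q T - δ)) →
      bndE (pn n pU) (qn n q) (Tn n T) a b ≤ η := by
  obtain ⟨N0, hN0⟩ := err_bound (ρ := fun a : U × V × Z => T a.1 a.2.1 a.2.2 / TU q T a.1 a.2.2)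
    h.gl_pmf (fun a ha => by
      obtain ⟨h1, h2, h3, h4, h5⟩ := h.pos ha
      exact div_pos h3 h4) hδ hC (half_pos hη)
  obtain ⟨N1, hN1⟩ := err_bound (ρ := fun a : U × V × Z => T a.1 a.2.1 a.2.2 / TQ pU q T a.2.2)
    h.gl_pmf (fun a ha => by
      obtain ⟨h1, h2, h3, h4, h5⟩ := h.pos ha
      exact div_pos h3 h5) hδ hC (half_pos hη)
  refine ⟨max N0 N1, fun n hn a b ha hb hb' hab => ?_⟩
  have e0 : ∑ a : U × V × Z, gl pU q T a * Real.logb 2 (T a.1 a.2.1 a.2.2 / TU q T a.1 a.2.2) =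
      infVU pU q T := by
    simp only [Fintype.sum_prod_type]; rfl
  have e1 : ∑ a : U × V × Z, gl pU q T a * Real.logb 2 (T a.1 a.2.1 a.2.2 / TQ pU q T a.2.2) =
      infUV pU q T := by
    simp only [Fintype.sum_prod_type]; rfl
  rw [e0] at hN0
  rw [e1] at hN1
  have ha1 : (0:ℝ) ≤ a - 1 := by
    have : (1:ℝ) ≤ a := by exact_mod_cast ha
    linarith
  have hb1 : (0:ℝ) ≤ b - 1 := by
    have : (1:ℝ) ≤ b := by exact_mod_cast hb
    linarith
  have b0 := hN0 n (le_of_max_le_left hn) (b - 1) hb1 hb'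
  have b1 := hN1 n (le_of_max_le_right hn) ((a - 1) * b) (by positivity) hab
  have : bndE (pn n pU) (qn n q) (Tn n T) a b ≤ η / 2 + η / 2 := by
    refine le_trans ?_ (add_le_add b0 b1)
    rw [← sum3, ← sum3]
    unfold bndE
    simp only [← Finset.sum_add_distrib]
    refine Finset.sum_le_sum fun us _ => Finset.sum_le_sum fun vs _ =>
      Finset.sum_le_sum fun zs _ => ?_
    refine ((h.pow n).le_bndE ha hb us vs zs).trans (le_of_eq ?_)
    rw [gl_prod, TU_pow, TQ_pow, Finset.prod_div_distrib, Finset.prod_div_distrib]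
    rfl
  linarith

end nfold
end

section


lemma mutInfo_equiv {α α' β : Type*} [Fintype α] [Fintype α'] [Fintype β] (φ : α ≃ α')
    (p : α × β → ℝ) : mutInfo (fun s : α' × β => p (φ.symm s.1, s.2)) = mutInfo p := by
  unfold mutInfo
  rw [← Equiv.sum_comp (Equiv.prodCongr φ (Equiv.refl β))]
  refine Finset.sum_congr rfl fun s _ => ?_
  have h : ∀ b, ∑ a : α', p (φ.symm a, b) = ∑ a : α, p (a, b) := fun b =>
    Equiv.sum_comp φ.symm (fun a => p (a, b))
  simp [h]

lemma sum2_prod_pi {n : ℕ} {β γ : Type*} [Fintype β] [Fintype γ] (F : Fin n → β → γ → ℝ) :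
    ∑ f : Fin n → β, ∑ g : Fin n → γ, ∏ i, F i (f i) (g i) = ∏ i, ∑ b, ∑ c, F i b c := by
  rw [← sum_prod_pi (fun i b => ∑ c, F i b c)]
  refine Finset.sum_congr rfl fun f _ => ?_
  rw [← sum_prod_pi (fun i c => F i (f i) c)]

lemma exists_dec {A B M D E : Type*} [Fintype A] [Fintype B] [Fintype M] [Fintype D] [Fintype E]
    [Nonempty A] [Nonempty B] [Nonempty M] [Nonempty D] [Nonempty E]
    [DecidableEq (M × A × D)]
    (t : A × B → M × D × E → ℝ) (ht : ∀ i j, 0 ≤ t i j) :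
    ∃ k : M × A × D, (∑ m : M × A × D, if k ≠ m then ∑ b : B, ∑ e : E,
      t (m.2.1, b) (m.1, m.2.2, e) else 0) ≤
      ∑ i, ∑ j, t i j * (1 - t i j / ∑ i', ∑ j', t i' j') := by
  classical
  obtain ⟨⟨i0, j0⟩, hm⟩ := Finite.exists_max (fun s : (A × B) × (M × D × E) => t s.1 s.2)
  have hmax : ∀ i j, t i j ≤ t i0 j0 := fun i j => hm (i, j)
  refine ⟨(j0.1, i0.1, j0.2.1), ?_⟩
  set S := ∑ i', ∑ j', t i' j' with hS
  set f : M × A × D → ℝ := fun m => ∑ b : B, ∑ e : E, t (m.2.1, b) (m.1, m.2.2, e) with hf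
  set k : M × A × D := (j0.1, i0.1, j0.2.1) with hk
  have h1 : (∑ m : M × A × D, if k ≠ m then f m else 0) = (∑ m, f m) - f k := by
    have : ∀ m, (if k ≠ m then f m else 0) = f m - if k = m then f m else 0 := by
      intro m; by_cases h : k = m <;> simp [h]
    simp_rw [this]
    rw [Finset.sum_sub_distrib]
    simp
  have h2 : ∑ m, f m = S := by
    rw [hS, hf]
    simp only [Fintype.sum_prod_type]
    rw [Finset.sum_comm]
    refine Finset.sum_congr rfl fun a _ => ?_
    have : ∀ x : M, ∑ d : D, ∑ b : B, ∑ e : E, t (a, b) (x, d, e) =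
      ∑ b : B, ∑ d : D, ∑ e : E, t (a, b) (x, d, e) := fun x => Finset.sum_comm
    simp_rw [this]
    rw [Finset.sum_comm]
  have h3 : t i0 j0 ≤ f k := by
    have e1 : t i0 j0 = t (k.2.1, i0.2) (k.1, k.2.2, j0.2.2) := rfl
    rw [e1]
    calc _ ≤ ∑ e : E, t (k.2.1, i0.2) (k.1, k.2.2, e) :=
          Finset.single_le_sum (f := fun e => t (k.2.1, i0.2) (k.1, k.2.2, e))
            (fun _ _ => ht _ _) (Finset.mem_univ j0.2.2)
      _ ≤ _ := Finset.single_le_sum (f := fun b => ∑ e : E, t (k.2.1, b) (k.1, k.2.2, e))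
            (fun _ _ => Finset.sum_nonneg fun _ _ => ht _ _) (Finset.mem_univ i0.2)
  have h4 : ∑ i, ∑ j, t i j * (1 - t i j / S) = S - (∑ i, ∑ j, t i j * t i j) / S := by
    simp_rw [mul_sub, mul_one, Finset.sum_sub_distrib, Finset.sum_div, mul_div_assoc]
    rfl
  have h5 : (∑ i, ∑ j, t i j * t i j) / S ≤ t i0 j0 := by
    have S0 : 0 ≤ S := Finset.sum_nonneg fun i _ => Finset.sum_nonneg fun j _ => ht i j
    rcases S0.eq_or_lt with e | e
    · rw [← e, div_zero]; exact ht _ _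
    · rw [div_le_iff₀ e, hS, Finset.mul_sum]
      refine Finset.sum_le_sum fun i _ => ?_
      rw [Finset.mul_sum]
      exact Finset.sum_le_sum fun j _ => mul_le_mul_of_nonneg_right (hmax i j) (ht i j)
  rw [h1, h2, h4]
  linarith

section comp
variable {U V X Z : Type*} [Fintype U] [Fintype V] [Fintype X] [Fintype Z]

/-- concatenation of prefix channel and output channel -/
def cc (κ : U → V → X → ℝ) (w : X → Z → ℝ) (u : U) (v : V) (z : Z) : ℝ := ∑ x, κ u v x * w x z

lemma cc_chan {κ : U → V → X → ℝ} {w : X → Z → ℝ} (hκ : ∀ u, IsChannel (κ u)) (hw : IsChannel w)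
    (u : U) : IsChannel (cc κ w u) := by
  intro v
  refine ⟨fun z => Finset.sum_nonneg fun x _ => mul_nonneg ((hκ u v).1 x) ((hw x).1 z), ?_⟩
  unfold cc
  rw [Finset.sum_comm]
  simp_rw [← Finset.mul_sum, (hw _).2, mul_one]
  exact (hκ u v).2

lemma Tn_cc (n : ℕ) (κ : U → V → X → ℝ) (w : X → Z → ℝ) (us : Fin n → U) (vs : Fin n → V)
    (zs : Fin n → Z) :
    Tn n (cc κ w) us vs zs = ∑ xs : Fin n → X, Tn n κ us vs xs * ∏ i, w (xs i) (zs i) := by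
  unfold Tn cc
  rw [← sum_prod_pi (fun i x => κ (us i) (vs i) x * w x (zs i))]
  simp_rw [Finset.prod_mul_distrib]

end comp

section code
variable {𝒳 𝒴 𝒵₁ 𝒵₂ : Type} [Fintype 𝒳] [Fintype 𝒴] [Fintype 𝒵₁] [Fintype 𝒵₂]

lemma WY_chan {W : 𝒳 → 𝒴 × 𝒵₁ × 𝒵₂ → ℝ} (hW : IsChannel W) : IsChannel (WY W) := by
  intro x
  refine ⟨fun y => Finset.sum_nonneg fun _ _ => Finset.sum_nonneg fun _ _ => (hW x).1 _, ?_⟩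
  rw [← (hW x).2]
  simp only [Fintype.sum_prod_type, WY]

lemma WZ1_chan {W : 𝒳 → 𝒴 × 𝒵₁ × 𝒵₂ → ℝ} (hW : IsChannel W) : IsChannel (WZ1 W) := by
  intro x
  refine ⟨fun y => Finset.sum_nonneg fun _ _ => Finset.sum_nonneg fun _ _ => (hW x).1 _, ?_⟩
  rw [← (hW x).2]
  simp only [Fintype.sum_prod_type, WZ1]
  rw [Finset.sum_comm]

lemma WZ2_chan {W : 𝒳 → 𝒴 × 𝒵₁ × 𝒵₂ → ℝ} (hW : IsChannel W) : IsChannel (WZ2 W) := by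
  intro x
  refine ⟨fun y => Finset.sum_nonneg fun _ _ => Finset.sum_nonneg fun _ _ => (hW x).1 _, ?_⟩
  rw [← (hW x).2]
  simp only [Fintype.sum_prod_type, WZ2]
  rw [Finset.sum_comm]
  refine Finset.sum_congr rfl fun y _ => ?_
  rw [Finset.sum_comm]

variable {U V : Type*} [Fintype U] [Fintype V] {n a b m d e : ℕ}

/-- renaming of messages -/
def phi (a m d : ℕ) : Fin m × Fin a × Fin d ≃ Fin m × Fin (a * d) :=
  Equiv.prodCongr (Equiv.refl _) finProdFinEquiv

/-- the stochastic superposition encoder -/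
def encM (κ : U → V → 𝒳 → ℝ)
    (c : Fin a × Fin b → (Fin n → U) × (Fin m × Fin d × Fin e → (Fin n → V)))
    (s : Fin m × Fin a × Fin d) (xs : Fin n → 𝒳) : ℝ :=
  ((b : ℝ) * e)⁻¹ * ∑ β : Fin b, ∑ ε : Fin e,
    Tn n κ (c (s.2.1, β)).1 ((c (s.2.1, β)).2 (s.1, s.2.2, ε)) xs

lemma encM_chan {κ : U → V → 𝒳 → ℝ} (hκ : ∀ u, IsChannel (κ u)) (hb : 0 < b) (he : 0 < e)
    (c : Fin a × Fin b → (Fin n → U) × (Fin m × Fin d × Fin e → (Fin n → V))) :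
    IsChannel (encM κ c) := by
  have hT : ∀ us vs, IsPMF (Tn n κ us vs) := fun us vs => chan_pi n _ fun i => hκ (us i) (vs i)
  intro s
  refine ⟨fun xs => mul_nonneg (by positivity) (Finset.sum_nonneg fun _ _ =>
    Finset.sum_nonneg fun _ _ => (hT _ _).1 _), ?_⟩
  unfold encM
  rw [← Finset.mul_sum, Finset.sum_comm]
  have : ∀ β : Fin b, ∑ xs : Fin n → 𝒳, ∑ ε : Fin e,
      Tn n κ (c (s.2.1, β)).1 ((c (s.2.1, β)).2 (s.1, s.2.2, ε)) xs = e := by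
    intro β
    rw [Finset.sum_comm]
    simp [(hT _ _).2]
  simp_rw [this]
  have hb' : (b:ℝ) ≠ 0 := by positivity
  have he' : (e:ℝ) ≠ 0 := by positivity
  simp
  field_simp

lemma encM_out {Z : Type*} [Fintype Z] (κ : U → V → 𝒳 → ℝ)
    (c : Fin a × Fin b → (Fin n → U) × (Fin m × Fin d × Fin e → (Fin n → V)))
    (w : 𝒳 → Z → ℝ) (s : Fin m × Fin a × Fin d) (zs : Fin n → Z) :
    ∑ xs, encM κ c s xs * ∏ i, w (xs i) (zs i) = ((b : ℝ) * e)⁻¹ * ∑ β : Fin b, ∑ ε : Fin e,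
      Tn n (cc κ w) (c (s.2.1, β)).1 ((c (s.2.1, β)).2 (s.1, s.2.2, ε)) zs := by
  simp_rw [Tn_cc, encM]
  simp_rw [mul_assoc, ← Finset.mul_sum, Finset.sum_mul]
  congr 1
  rw [Finset.sum_comm]
  refine Finset.sum_congr rfl fun β _ => ?_
  rw [Finset.sum_comm]

variable (W : 𝒳 → 𝒴 × 𝒵₁ × 𝒵₂ → ℝ) (κ : U → V → 𝒳 → ℝ)
    (c : Fin a × Fin b → (Fin n → U) × (Fin m × Fin d × Fin e → (Fin n → V)))

lemma leakMZ2_eq : leakMZ2 W (fun p => encM κ c ((phi a m d).symm p)) =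
    mutInfo (jnt2 (Tn n (cc κ (WZ2 W))) c) := by
  rw [← mutInfo_equiv (phi a m d)]
  unfold leakMZ2
  congr 1
  funext s
  unfold codeJoint jnt2
  simp_rw [← Finset.mul_sum]
  have h : ∀ xs : Fin n → 𝒳, ∑ ys : Fin n → 𝒴, ∑ z1s : Fin n → 𝒵₁,
      ∏ i, W (xs i) (ys i, z1s i, s.2 i) = ∏ i, WZ2 W (xs i) (s.2 i) := fun xs =>
    sum2_prod_pi (fun i y z => W (xs i) (y, z, s.2 i))
  simp_rw [h, mul_assoc, ← Finset.mul_sum]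
  rw [encM_out]
  simp only [Fintype.card_fin]
  rw [← mul_assoc, ← mul_inv]
  push_cast
  congr 2
  ring

lemma leakM1Z1_eq : leakM1Z1 W (fun p => encM κ c ((phi a m d).symm p)) =
    mutInfo (jnt1 (Tn n (cc κ (WZ1 W))) c) := by
  unfold leakM1Z1
  congr 1
  funext s
  unfold codeJoint jnt1
  simp_rw [← Finset.mul_sum]
  have h : ∀ xs : Fin n → 𝒳, ∑ ys : Fin n → 𝒴, ∑ z2s : Fin n → 𝒵₂,
      ∏ i, W (xs i) (ys i, s.2 i, z2s i) = ∏ i, WZ1 W (xs i) (s.2 i) := fun xs =>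
    sum2_prod_pi (fun i y z => W (xs i) (y, s.2 i, z))
  simp_rw [h, mul_assoc, ← Finset.mul_sum]
  simp_rw [encM_out]
  rw [← Equiv.sum_comp finProdFinEquiv]
  simp only [phi, Equiv.prodCongr_symm, Equiv.prodCongr_apply, Prod.map, Equiv.refl_symm,
    Equiv.refl_apply, Equiv.symm_apply_apply, Fintype.sum_prod_type, ← Finset.mul_sum,
    Fintype.card_fin, Fintype.card_prod]
  rw [← mul_assoc, ← mul_inv]
  push_cast
  congr 1
  · congr 1; ring
  · exact Finset.sum_congr rfl fun _ _ => Finset.sum_comm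

lemma errProb_eq (dec : (Fin n → 𝒴) → Fin m × Fin a × Fin d) :
    errProb W (fun p => encM κ c ((phi a m d).symm p)) (fun ys => phi a m d (dec ys)) =
    (((a : ℝ) * b) * ((m : ℝ) * (d * e)))⁻¹ * ∑ ys, ∑ s : Fin m × Fin a × Fin d,
      if dec ys ≠ s then ∑ β : Fin b, ∑ ε : Fin e,
        Tn n (cc κ (WY W)) (c (s.2.1, β)).1 ((c (s.2.1, β)).2 (s.1, s.2.2, ε)) ys else 0 := by
  unfold errProb
  rw [← Equiv.sum_comp (phi a m d), Finset.sum_comm (s := Finset.univ (α := Fin n → 𝒴)),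
    Finset.mul_sum]
  refine Finset.sum_congr rfl fun s _ => ?_
  rw [Finset.sum_comm, Finset.mul_sum]
  refine Finset.sum_congr rfl fun ys _ => ?_
  simp only [ne_eq, EmbeddingLike.apply_eq_iff_eq]
  by_cases hd : dec ys = s
  · simp [hd]
  simp only [hd, not_false_eq_true, if_true]
  unfold codeJoint
  simp_rw [← Finset.mul_sum]
  have h : ∀ xs : Fin n → 𝒳, ∑ z1s : Fin n → 𝒵₁, ∑ z2s : Fin n → 𝒵₂,
      ∏ i, W (xs i) (ys i, z1s i, z2s i) = ∏ i, WY W (xs i) (ys i) := fun xs =>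
    sum2_prod_pi (fun i z z' => W (xs i) (ys i, z, z'))
  simp_rw [h, mul_assoc, ← Finset.mul_sum]
  rw [encM_out]
  simp only [Equiv.symm_apply_apply]
  rw [← mul_assoc, ← mul_inv]
  push_cast
  congr 2
  ring

lemma exists_dec_err [Nonempty (Fin a)] [Nonempty (Fin b)] [Nonempty (Fin m)] [Nonempty (Fin d)]
    [Nonempty (Fin e)] (hW : IsChannel W) (hκ : ∀ u, IsChannel (κ u)) :
    ∃ dec, errProb W (fun p => encM κ c ((phi a m d).symm p)) dec ≤
      ((Fintype.card (Fin a × Fin b) : ℝ) * Fintype.card (Fin m × Fin d × Fin e))⁻¹ *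
      ∑ i, ∑ j, ∑ z, Tn n (cc κ (WY W)) (c i).1 ((c i).2 j) z *
        (1 - Tn n (cc κ (WY W)) (c i).1 ((c i).2 j) z /
          ∑ i', ∑ j', Tn n (cc κ (WY W)) (c i').1 ((c i').2 j') z) := by
  have hT : ∀ us vs ys, 0 ≤ Tn n (cc κ (WY W)) us vs ys := fun us vs ys =>
    (chan_pi n _ fun i => cc_chan hκ (WY_chan hW) (us i) (vs i)).1 ys
  choose k hk using fun ys => exists_dec
    (fun i j => Tn n (cc κ (WY W)) (c i).1 ((c i).2 j) ys) (fun i j => hT _ _ ys)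
  refine ⟨fun ys => phi a m d (k ys), ?_⟩
  rw [errProb_eq]
  simp only [Fintype.card_prod, Fintype.card_fin]
  push_cast
  apply mul_le_mul_of_nonneg_left _ (by positivity)
  refine (Finset.sum_le_sum fun ys _ => hk ys).trans (le_of_eq ?_)
  rw [Finset.sum_comm]
  refine Finset.sum_congr rfl fun i _ => ?_
  rw [Finset.sum_comm]

end code
end

section


lemma select {C : Type*} [Fintype C] {P : C → ℝ} (hP : IsPMF P) {f g h : C → ℝ}
    (hf : ∀ c, 0 ≤ f c) (hg : ∀ c, 0 ≤ g c) (hh : ∀ c, 0 ≤ h c) {x y z : ℝ}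
    (hx : 0 < x) (hy : 0 < y) (hz : 0 < z) (ef : ∑ c, P c * f c ≤ x) (eg : ∑ c, P c * g c ≤ y)
    (eh : ∑ c, P c * h c ≤ z) : ∃ c, f c ≤ 3 * x ∧ g c ≤ 3 * y ∧ h c ≤ 3 * z := by
  by_contra hcon
  push Not at hcon
  have key : ∀ c, 3 < f c / x + g c / y + h c / z := by
    intro c
    have p1 := div_nonneg (hf c) hx.le
    have p2 := div_nonneg (hg c) hy.le
    have p3 := div_nonneg (hh c) hz.le
    by_cases h1 : f c ≤ 3 * x
    · by_cases h2 : g c ≤ 3 * y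
      · have := hcon c h1 h2
        rw [← lt_div_iff₀ hz] at this
        linarith
      · rw [not_le, ← lt_div_iff₀ hy] at h2
        linarith
    · rw [not_le, ← lt_div_iff₀ hx] at h1
      linarith
  have s1 : ∑ c, P c * (f c / x + g c / y + h c / z) ≤ 3 := by
    have : ∑ c, P c * (f c / x + g c / y + h c / z) = (∑ c, P c * f c) / x + (∑ c, P c * g c) / y +
        (∑ c, P c * h c) / z := by
      simp_rw [Finset.sum_div, ← Finset.sum_add_distrib]
      refine Finset.sum_congr rfl fun c _ => ?_
      ring
    rw [this]
    have := (div_le_one hx).2 ef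
    have := (div_le_one hy).2 eg
    have := (div_le_one hz).2 eh
    linarith
  have s2 : ∑ c, P c * 3 < ∑ c, P c * (f c / x + g c / y + h c / z) := by
    have hex : ∃ c, 0 < P c := by
      by_contra hn
      push Not at hn
      have : ∑ c, P c ≤ 0 := Finset.sum_nonpos fun c _ => hn c
      rw [hP.2] at this
      linarith
    obtain ⟨c0, hc0⟩ := hex
    exact Finset.sum_lt_sum (fun c _ => mul_le_mul_of_nonneg_left (key c).le (hP.1 c))
      ⟨c0, Finset.mem_univ _, mul_lt_mul_of_pos_left (key c0) hc0⟩
  rw [← Finset.sum_mul, hP.2] at s2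
  linarith

section jp
variable {U V Z A B M D E : Type*} [Fintype U] [Fintype V] [Fintype Z]
  [Fintype A] [Fintype B] [Fintype M] [Fintype D] [Fintype E]
  [Nonempty A] [Nonempty B] [Nonempty M] [Nonempty D] [Nonempty E]
variable {T : U → V → Z → ℝ}

lemma jnt2_pmf (hT : ∀ u, IsChannel (T u)) (c : A × B → U × (M × D × E → V)) :
    IsPMF (jnt2 T c) := by
  refine ⟨fun s => mul_nonneg (by positivity) (Finset.sum_nonneg fun _ _ =>
    Finset.sum_nonneg fun _ _ => (hT _ _).1 _), ?_⟩
  rw [Fintype.sum_prod_type]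
  have cA : (Fintype.card A : ℝ) ≠ 0 := by positivity
  have cB : (Fintype.card B : ℝ) ≠ 0 := by positivity
  have cM : (Fintype.card M : ℝ) ≠ 0 := by positivity
  have cD : (Fintype.card D : ℝ) ≠ 0 := by positivity
  have cE : (Fintype.card E : ℝ) ≠ 0 := by positivity
  have h : ∀ s : M × A × D, ∑ z, jnt2 T c (s, z) =
      ((Fintype.card M : ℝ) * Fintype.card A * Fintype.card D)⁻¹ := by
    intro s
    unfold jnt2
    rw [← Finset.mul_sum, Finset.sum_comm]
    have : ∀ b : B, ∑ z, ∑ e : E, T (c (s.2.1, b)).1 ((c (s.2.1, b)).2 (s.1, s.2.2, e)) z =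
        Fintype.card E := by
      intro b
      rw [Finset.sum_comm]
      simp [(hT _ _).2]
    simp only [this]
    simp
    field_simp
  simp_rw [h]
  simp
  field_simp

lemma jnt1_pmf (hT : ∀ u, IsChannel (T u)) (c : A × B → U × (M × D × E → V)) :
    IsPMF (jnt1 T c) := by
  refine ⟨fun s => Finset.sum_nonneg fun _ _ => mul_nonneg (by positivity)
    (Finset.sum_nonneg fun _ _ => Finset.sum_nonneg fun _ _ => (hT _ _).1 _), ?_⟩
  rw [Fintype.sum_prod_type]
  have cA : (Fintype.card A : ℝ) ≠ 0 := by positivity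
  have cB : (Fintype.card B : ℝ) ≠ 0 := by positivity
  have cM : (Fintype.card M : ℝ) ≠ 0 := by positivity
  have cD : (Fintype.card D : ℝ) ≠ 0 := by positivity
  have cE : (Fintype.card E : ℝ) ≠ 0 := by positivity
  have h : ∀ s : M, ∑ z, jnt1 T c (s, z) = (Fintype.card M : ℝ)⁻¹ := by
    intro s
    unfold jnt1
    rw [Finset.sum_comm]
    have : ∀ i : A × B, ∑ z, ((Fintype.card (A × B) : ℝ) * Fintype.card M *
        (Fintype.card D * Fintype.card E))⁻¹ * ∑ d : D, ∑ e : E, T (c i).1 ((c i).2 (s, d, e)) z =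
        ((Fintype.card (A × B) : ℝ) * Fintype.card M)⁻¹ := by
      intro i
      rw [← Finset.mul_sum, Finset.sum_comm]
      have : ∀ d : D, ∑ z, ∑ e : E, T (c i).1 ((c i).2 (s, d, e)) z = Fintype.card E := by
        intro d
        rw [Finset.sum_comm]
        simp [(hT _ _).2]
      simp only [this]
      simp
      field_simp
    simp only [this]
    simp
    field_simp
  simp_rw [h]
  simp

end jp

/-- size bookkeeping -/
structure Szb (n : ℕ) (δ : ℝ) (N : ℕ) (r C C' : ℝ) : Prop where
  pos : 0 < N
  r0 : 0 ≤ r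
  sub : (N : ℝ) - 1 ≤ C * (2:ℝ) ^ ((n:ℝ) * (r - δ))
  le : (N : ℝ) ≤ C' * (2:ℝ) ^ ((n:ℝ) * r)

/-- code size -/
def sz (n : ℕ) (ρ : ℝ) : ℕ := ⌈(2:ℝ) ^ ((n:ℝ) * ρ)⌉₊

lemma sz_ge (n : ℕ) (ρ : ℝ) : (2:ℝ) ^ ((n:ℝ) * ρ) ≤ sz n ρ := Nat.le_ceil _

lemma sz_szb (n : ℕ) {δ r : ℝ} (hδ : 0 < δ) (hr : 0 ≤ r) : Szb n δ (sz n (r - δ)) r 1 2 := by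
  have h0 : (0:ℝ) < (2:ℝ) ^ ((n:ℝ) * (r - δ)) := by positivity
  have h1 := (Nat.ceil_lt_add_one h0.le).le
  have h2 : (2:ℝ) ^ ((n:ℝ) * (r - δ)) ≤ (2:ℝ) ^ ((n:ℝ) * r) :=
    Real.rpow_le_rpow_of_exponent_le (by norm_num)
      (mul_le_mul_of_nonneg_left (by linarith) (Nat.cast_nonneg n))
  have h3 : (1:ℝ) ≤ (2:ℝ) ^ ((n:ℝ) * r) := Real.one_le_rpow (by norm_num) (by positivity)
  refine ⟨Nat.ceil_pos.2 h0, hr, ?_, ?_⟩ <;> unfold sz <;> linarith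

lemma Szb.mul {n N N' : ℕ} {δ r r' C C' D D' : ℝ} (h : Szb n δ N r C C') (h' : Szb n δ N' r' D D')
    (hC : 0 ≤ C) (hC' : 0 ≤ C') (hD : 0 ≤ D) (hD' : 0 ≤ D') :
    Szb n δ (N * N') (r + r') (C * D' + D) (C' * D') := by
  have e1 : (2:ℝ) ^ ((n:ℝ) * (r - δ)) * (2:ℝ) ^ ((n:ℝ) * r') = (2:ℝ) ^ ((n:ℝ) * (r + r' - δ)) := by
    rw [← Real.rpow_add (by norm_num)]; congr 1; ring
  have e2 : (2:ℝ) ^ ((n:ℝ) * r) * (2:ℝ) ^ ((n:ℝ) * r') = (2:ℝ) ^ ((n:ℝ) * (r + r')) := by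
    rw [← Real.rpow_add (by norm_num)]; congr 1; ring
  have e3 : (2:ℝ) ^ ((n:ℝ) * (r' - δ)) ≤ (2:ℝ) ^ ((n:ℝ) * (r + r' - δ)) :=
    Real.rpow_le_rpow_of_exponent_le (by norm_num)
      (mul_le_mul_of_nonneg_left (by linarith [h.r0]) (Nat.cast_nonneg n))
  have N1 : (1:ℝ) ≤ N := by exact_mod_cast h.pos
  refine ⟨Nat.mul_pos h.pos h'.pos, add_nonneg h.r0 h'.r0, ?_, ?_⟩
  · push_cast
    have s1 : ((N:ℝ) - 1) * N' ≤ (C * (2:ℝ) ^ ((n:ℝ) * (r - δ))) * (D' * (2:ℝ) ^ ((n:ℝ) * r')) :=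
      mul_le_mul h.sub h'.le (by positivity) (by positivity)
    have s2 : (C * (2:ℝ) ^ ((n:ℝ) * (r - δ))) * (D' * (2:ℝ) ^ ((n:ℝ) * r')) =
        C * D' * (2:ℝ) ^ ((n:ℝ) * (r + r' - δ)) := by rw [← e1]; ring
    have s3 := h'.sub.trans (mul_le_mul_of_nonneg_left e3 hD)
    nlinarith
  · push_cast
    calc (N:ℝ) * N' ≤ (C' * (2:ℝ) ^ ((n:ℝ) * r)) * (D' * (2:ℝ) ^ ((n:ℝ) * r')) :=
          mul_le_mul h.le h'.le (by positivity) (by positivity)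
      _ = _ := by rw [← e2]; ring

section core
variable {𝒳 𝒴 𝒵₁ 𝒵₂ : Type} [Fintype 𝒳] [Fintype 𝒴] [Fintype 𝒵₁] [Fintype 𝒵₂]
variable {U V : Type} [Fintype U] [Fintype V]

theorem core (W : 𝒳 → 𝒴 × 𝒵₁ × 𝒵₂ → ℝ) (hW : IsChannel W) {pU : U → ℝ} {q : U → V → ℝ}
    {κ : U → V → 𝒳 → ℝ} (hκ : ∀ u, IsChannel (κ u)) (hp : IsPMF pU) (hq : IsChannel q)
    (ha : infU pU q (cc κ (WZ2 W)) ≤ infU pU q (cc κ (WY W)))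
    (hb1 : infVU pU q (cc κ (WZ1 W)) ≤ infVU pU q (cc κ (WY W)))
    (hb2 : infVU pU q (cc κ (WZ2 W)) ≤ infVU pU q (cc κ (WZ1 W))) :
    Achievable W (infVU pU q (cc κ (WY W)) - infVU pU q (cc κ (WZ1 W)))
      ((infU pU q (cc κ (WY W)) - infU pU q (cc κ (WZ2 W))) +
        (infVU pU q (cc κ (WZ1 W)) - infVU pU q (cc κ (WZ2 W)))) := by
  have hY : Sys pU q (cc κ (WY W)) := ⟨hp, hq, cc_chan hκ (WY_chan hW)⟩
  have h1 : Sys pU q (cc κ (WZ1 W)) := ⟨hp, hq, cc_chan hκ (WZ1_chan hW)⟩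
  have h2 : Sys pU q (cc κ (WZ2 W)) := ⟨hp, hq, cc_chan hκ (WZ2_chan hW)⟩
  have cY := hY.chain
  have c2 := h2.chain
  have a20 := h2.infU_nonneg
  have b20 := h2.infVU_nonneg
  set a := infU pU q (cc κ (WY W)) with ea
  set a2 := infU pU q (cc κ (WZ2 W)) with ea2
  set b := infVU pU q (cc κ (WY W)) with eb
  set b1 := infVU pU q (cc κ (WZ1 W)) with eb1
  set b2 := infVU pU q (cc κ (WZ2 W)) with eb2
  intro ε hε
  set δ := ε / 36 with hδ'
  have hδ : 0 < δ := by positivity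
  obtain ⟨NE, hNE⟩ := hY.bndE_pow hδ (C := 24) (by norm_num) (show 0 < ε / 3 by positivity)
  obtain ⟨N1, hN1⟩ := h1.bnd1_pow (show 0 < 2 * δ by positivity)
  obtain ⟨N2, hN2⟩ := h2.bnd2_pow (show 0 < 2 * δ by positivity)
  rw [cY, ← eb] at hNE
  rw [← eb1] at hN1
  rw [c2, ← ea2] at hN2
  set n := max (max NE 1) (max N1 N2) with hn
  have nE : NE ≤ n := (le_max_left _ _).trans (le_max_left _ _)
  have n0 : 0 < n := lt_of_lt_of_le one_pos ((le_max_right NE 1).trans (le_max_left _ _))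
  have n1 : N1 ≤ n := (le_max_left _ _).trans (le_max_right _ _)
  have n2 : N2 ≤ n := (le_max_right _ _).trans (le_max_right _ _)
  clear_value n
  have n0' : (0:ℝ) < n := by exact_mod_cast n0
  have zA := sz_szb n hδ (sub_nonneg.2 ha)
  have zB := sz_szb n hδ a20
  have zM := sz_szb n hδ (sub_nonneg.2 hb1)
  have zD := sz_szb n hδ (sub_nonneg.2 hb2)
  have zE := sz_szb n hδ b20
  have gA := sz_ge n (a - a2 - δ)
  have gB := sz_ge n (a2 - δ)
  have gM := sz_ge n (b - b1 - δ)
  have gD := sz_ge n (b1 - b2 - δ)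
  have gE := sz_ge n (b2 - δ)
  have zI := zA.mul zB (by norm_num) (by norm_num) (by norm_num) (by norm_num)
  have zJ := zM.mul (zD.mul zE (by norm_num) (by norm_num) (by norm_num) (by norm_num))
    (by norm_num) (by norm_num) (by norm_num) (by norm_num)
  set A := sz n (a - a2 - δ)
  set B := sz n (a2 - δ)
  set M := sz n (b - b1 - δ)
  set D := sz n (b1 - b2 - δ)
  set E := sz n (b2 - δ)
  clear_value A B M D E
  have : Nonempty (Fin A) := ⟨⟨0, zA.pos⟩⟩
  have : Nonempty (Fin B) := ⟨⟨0, zB.pos⟩⟩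
  have : Nonempty (Fin M) := ⟨⟨0, zM.pos⟩⟩
  have : Nonempty (Fin D) := ⟨⟨0, zD.pos⟩⟩
  have : Nonempty (Fin E) := ⟨⟨0, zE.pos⟩⟩
  have fe : ∀ t s : ℝ, (2:ℝ) ^ ((n:ℝ) * t) * (2:ℝ) ^ ((n:ℝ) * s) = (2:ℝ) ^ ((n:ℝ) * (t + s)) := by
    intro t s
    rw [← Real.rpow_add (by norm_num), mul_add]
  have fm : ∀ {t s : ℝ}, t ≤ s → (2:ℝ) ^ ((n:ℝ) * t) ≤ (2:ℝ) ^ ((n:ℝ) * s) := fun h =>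
    Real.rpow_le_rpow_of_exponent_le (by norm_num) (mul_le_mul_of_nonneg_left h n0'.le)
  -- the expected bounds
  have EE := (hY.pow n).cb_errE (I := Fin A × Fin B) (J := Fin M × Fin D × Fin E)
  have E1 := (h1.pow n).leak1 (A := Fin A) (B := Fin B) (M := Fin M) (D := Fin D) (E := Fin E)
  have E2 := (h2.pow n).leak2 (A := Fin A) (B := Fin B) (M := Fin M) (D := Fin D) (E := Fin E)
  have BE := hNE n nE (A * B) (M * (D * E)) zI.pos zJ.pos (by
      have := zJ.sub
      rw [show b - b1 + (b1 - b2 + b2) - δ = b - δ by ring] at this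
      refine this.trans (mul_le_mul_of_nonneg_right (by norm_num) (by positivity))) (by
      have i1 := zI.sub
      have j1 := zJ.le
      rw [show a - a2 + a2 - δ = a - δ by ring] at i1
      rw [show b - b1 + (b1 - b2 + b2) = b by ring] at j1
      calc _ ≤ ((1 * 2 + 1) * (2:ℝ) ^ ((n:ℝ) * (a - δ))) * ((2 * (2 * 2)) * (2:ℝ) ^ ((n:ℝ) * b)) :=
            mul_le_mul i1 j1 (by positivity) (by positivity)
        _ = 24 * ((2:ℝ) ^ ((n:ℝ) * (a - δ)) * (2:ℝ) ^ ((n:ℝ) * b)) := by ring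
        _ = _ := by rw [fe]; congr 3; ring)
  have B1 := hN1 n n1 (D * E) (by
      push_cast
      calc _ = (2:ℝ) ^ ((n:ℝ) * (b1 - b2 - δ)) * (2:ℝ) ^ ((n:ℝ) * (b2 - δ)) := by
            rw [fe]; congr 2; ring
        _ ≤ _ := mul_le_mul gD gE (by positivity) (by positivity))
  have B2 := hN2 n n2 B E ((fm (by linarith)).trans gB) (by
      calc _ = (2:ℝ) ^ ((n:ℝ) * (a2 - δ)) * (2:ℝ) ^ ((n:ℝ) * (b2 - δ)) := by
            rw [fe]; congr 2; ring
        _ ≤ _ := mul_le_mul gB gE (by positivity) (by positivity))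
  simp only [Fintype.card_fin] at E1 E2
  push_cast at B1
  have EE' := EE.trans (by simpa only [Fintype.card_prod, Fintype.card_fin] using BE)
  have E1' := E1.trans B1
  have E2' := E2.trans B2
  have hP := cb_pmf (I := Fin A × Fin B) (J := Fin M × Fin D × Fin E) (hY.pow n).pU (hY.pow n).q
  obtain ⟨c, cE, cL1, cL2⟩ := select hP (fun c => by
      refine mul_nonneg (by positivity) (Finset.sum_nonneg fun i _ => Finset.sum_nonneg fun j _ =>
        Finset.sum_nonneg fun z _ => ?_)
      have t0 : ∀ i j, 0 ≤ Tn n (cc κ (WY W)) (c i).1 ((c i).2 j) z := fun i j =>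
        ((hY.pow n).T _ _).1 z
      refine mul_nonneg (t0 i j) (sub_nonneg.2 (div_le_one_of_le₀ ?_ ?_))
      · calc _ ≤ ∑ j', Tn n (cc κ (WY W)) (c i).1 ((c i).2 j') z :=
              Finset.single_le_sum (f := fun j' => Tn n (cc κ (WY W)) (c i).1 ((c i).2 j') z)
                (fun _ _ => t0 _ _) (Finset.mem_univ j)
          _ ≤ _ := Finset.single_le_sum
                (f := fun i' => ∑ j', Tn n (cc κ (WY W)) (c i').1 ((c i').2 j') z)
                (fun _ _ => Finset.sum_nonneg fun _ _ => t0 _ _) (Finset.mem_univ i)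
      · exact Finset.sum_nonneg fun _ _ => Finset.sum_nonneg fun _ _ => t0 _ _)
    (fun c => mutInfo_nonneg (jnt1_pmf (h1.pow n).T c))
    (fun c => mutInfo_nonneg (jnt2_pmf (h2.pow n).T c))
    (show 0 < ε / 3 by positivity) (show 0 < 3 * n * (2 * δ) by positivity)
    (show 0 < 6 * n * (2 * δ) by positivity) EE' E1' E2'
  obtain ⟨dec, hdec⟩ := exists_dec_err W κ c hW hκ
  have lg : ∀ {t : ℝ} {N : ℝ}, (2:ℝ) ^ ((n:ℝ) * t) ≤ N → n * t ≤ Real.logb 2 N := by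
    intro t N h
    have := Real.logb_le_logb_of_le (b := 2) (by norm_num) (by positivity) h
    rwa [Real.logb_rpow (by norm_num) (by norm_num)] at this
  refine ⟨n, n0, M, A * D, zM.pos, Nat.mul_pos zA.pos zD.pos, ?_, ?_,
    fun p => encM κ c ((phi A M D).symm p), ?_, dec, ?_, ?_, ?_⟩
  · refine lg ((fm ?_).trans gM)
    linarith
  · refine lg ?_
    push_cast
    calc _ ≤ (2:ℝ) ^ ((n:ℝ) * ((a - a2 - δ) + (b1 - b2 - δ))) := fm (by linarith)
      _ = (2:ℝ) ^ ((n:ℝ) * (a - a2 - δ)) * (2:ℝ) ^ ((n:ℝ) * (b1 - b2 - δ)) := (fe _ _).symm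
      _ ≤ _ := mul_le_mul gA gD (by positivity) (by positivity)
  · intro p
    exact encM_chan hκ zB.pos zE.pos c _
  · refine (hdec.trans cE).trans (by linarith)
  · rw [leakMZ2_eq]
    refine cL2.trans (le_of_eq ?_)
    rw [hδ']; ring
  · rw [leakM1Z1_eq]
    refine cL1.trans ?_
    have : 3 * (3 * n * (2 * δ)) = n * (ε / 2) := by rw [hδ']; ring
    rw [this]
    exact mul_le_mul_of_nonneg_left (by linarith) n0'.le

end core
end

/-- a two-level security wiretap channel (with `X → Z₁ → Z₂`) is perfectly
embeddable if there exist auxiliaries `U → V → X → (Y,Z₁,Z₂)` with `I(U;Y) ≥ I(U;Z₂)`,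
such that the marginal `p(v,x)` is optimal for `max [I(V;Y) − I(V;Z₂)]` and
`I(V;Y|U) − I(V;Z₁|U)` equals `max_{p(w,x)} [I(W;Y) − I(W;Z₁)]`. -/
theorem stmt3_perfectly_embeddable_sufficient_condition
    (W : 𝒳 → 𝒴 × 𝒵₁ × 𝒵₂ → ℝ) (hW : IsChannel W) (hdeg : DegradedZ1Z2 W)
    {𝒰 𝒱 : Type} [Fintype 𝒰] [Fintype 𝒱]
    (pUVX : 𝒰 × 𝒱 × 𝒳 → ℝ) (hpUVX : IsPMF pUVX)
    -- Markov chain U → V → X (so that U → V → X → (Y,Z₁,Z₂) holds for the memoryless channel)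
    (hMarkov : ∀ u v x,
      pUVX (u, v, x) * (∑ u', ∑ x', pUVX (u', v, x')) =
        (∑ x', pUVX (u, v, x')) * (∑ u', pUVX (u', v, x)))
    -- I(U;Y) ≥ I(U;Z₂)
    (hUY : mutInfo (fun q : 𝒰 × 𝒴 => ∑ v, ∑ x, pUVX (q.1, v, x) * WY W x q.2) ≥
      mutInfo (fun q : 𝒰 × 𝒵₂ => ∑ v, ∑ x, pUVX (q.1, v, x) * WZ2 W x q.2))
    -- the marginal p(v,x) is an optimal solution of max_{p(v,x)} [I(V;Y) − I(V;Z₂)]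
    (hopt : mutInfo (fun q : 𝒱 × 𝒴 => ∑ u, ∑ x, pUVX (u, q.1, x) * WY W x q.2) -
        mutInfo (fun q : 𝒱 × 𝒵₂ => ∑ u, ∑ x, pUVX (u, q.1, x) * WZ2 W x q.2) =
      wiretapCapZ2 W)
    -- I(V;Y|U) − I(V;Z₁|U) = max_{p(w,x)} [I(W;Y) − I(W;Z₁)]
    (heq : condMutInfo (fun t : 𝒱 × 𝒴 × 𝒰 => ∑ x, pUVX (t.2.2, t.1, x) * WY W x t.2.1) -
        condMutInfo (fun t : 𝒱 × 𝒵₁ × 𝒰 => ∑ x, pUVX (t.2.2, t.1, x) * WZ1 W x t.2.1) =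
      wiretapCapZ1 W) :
    PerfectlyEmbeddable W := by
  classical
  -- disintegration
  set rX : 𝒳 → ℝ := fun x => ∑ u, ∑ v, pUVX (u, v, x) with hrX
  set rV : 𝒱 → ℝ := fun v => ∑ u, ∑ x, pUVX (u, v, x) with hrV
  have tot : ∑ u, ∑ v, ∑ x, pUVX (u, v, x) = 1 := by
    rw [← hpUVX.2]; simp only [Fintype.sum_prod_type]
  have hrX' : IsPMF rX := by
    refine ⟨fun x => Finset.sum_nonneg fun _ _ => Finset.sum_nonneg fun _ _ => hpUVX.1 _, ?_⟩
    rw [← tot, hrX, Finset.sum_comm]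
    exact Finset.sum_congr rfl fun u _ => Finset.sum_comm
  have hrV' : IsPMF rV := by
    refine ⟨fun x => Finset.sum_nonneg fun _ _ => Finset.sum_nonneg fun _ _ => hpUVX.1 _, ?_⟩
    rw [← tot, hrV, Finset.sum_comm]
  obtain ⟨κ', hκ', eκ⟩ := exists_disint (fun (s : 𝒰 × 𝒱) x => pUVX (s.1, s.2, x))
    (fun _ _ => hpUVX.1 _) rX hrX'
  obtain ⟨q, hq, eq⟩ := exists_disint (fun (u : 𝒰) (v : 𝒱) => ∑ x, pUVX (u, v, x))
    (fun _ _ => Finset.sum_nonneg fun _ _ => hpUVX.1 _) rV hrV'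
  set κ : 𝒰 → 𝒱 → 𝒳 → ℝ := fun u v x => κ' (u, v) x with hκdef
  have hκ : ∀ u, IsChannel (κ u) := fun u v => hκ' (u, v)
  set pU : 𝒰 → ℝ := fun u => ∑ v, ∑ x, pUVX (u, v, x) with hpU
  have hp : IsPMF pU := ⟨fun u => Finset.sum_nonneg fun _ _ => Finset.sum_nonneg fun _ _ =>
    hpUVX.1 _, tot⟩
  have fac2 : ∀ u v, pU u * q u v = ∑ x, pUVX (u, v, x) := fun u v => eq u v
  have fac : ∀ u v x, pU u * q u v * κ u v x = pUVX (u, v, x) := by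
    intro u v x
    rw [fac2]
    exact eκ (u, v) x
  have facW : ∀ {Z : Type} [Fintype Z] (w : 𝒳 → Z → ℝ) u v z,
      ∑ x, pUVX (u, v, x) * w x z = pU u * q u v * cc κ w u v z := by
    intro Z _ w u v z
    unfold cc
    rw [Finset.mul_sum]
    refine Finset.sum_congr rfl fun x _ => ?_
    rw [← fac]; ring
  have hM : ∀ {Z : Type} [Fintype Z] (w : 𝒳 → Z → ℝ) (u : 𝒰) (v : 𝒱) (z : Z),
      pU u * q u v * cc κ w u v z * (∑ u', pU u' * q u' v) =
        pU u * q u v * ∑ u', pU u' * q u' v * cc κ w u' v z := by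
    intro Z _ w u v z
    simp_rw [← facW]
    simp_rw [fac2]
    have sw : ∑ u', ∑ x, pUVX (u', v, x) * w x z = ∑ x, ∑ u', pUVX (u', v, x) * w x z :=
      Finset.sum_comm
    rw [sw, Finset.sum_mul, Finset.mul_sum]
    refine Finset.sum_congr rfl fun x _ => ?_
    rw [← Finset.sum_mul, ← mul_assoc, ← hMarkov u v x]
    ring
  have hY : Sys pU q (cc κ (WY W)) := ⟨hp, hq, cc_chan hκ (WY_chan hW)⟩
  have h1 : Sys pU q (cc κ (WZ1 W)) := ⟨hp, hq, cc_chan hκ (WZ1_chan hW)⟩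
  have h2 : Sys pU q (cc κ (WZ2 W)) := ⟨hp, hq, cc_chan hκ (WZ2_chan hW)⟩
  simp only [facW] at hUY hopt heq
  rw [hY.mutInfo_U, h2.mutInfo_U] at hUY
  rw [hY.mutInfo_V (hM (WY W)), h2.mutInfo_V (hM (WZ2 W)), hY.chain, h2.chain] at hopt
  rw [hY.condMutInfo_VU, h1.condMutInfo_VU] at heq
  have hb2 : infVU pU q (cc κ (WZ2 W)) ≤ infVU pU q (cc κ (WZ1 W)) := by
    obtain ⟨dq, hd, ed⟩ := hdeg
    refine h1.dpi dq hd _ fun u v z => ?_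
    unfold cc
    simp_rw [Finset.sum_mul]
    rw [Finset.sum_comm]
    refine Finset.sum_congr rfl fun x _ => ?_
    simp_rw [mul_assoc, ← Finset.mul_sum]
    congr 1
    unfold WZ2 WZ1
    rw [Finset.sum_comm]
    exact Finset.sum_congr rfl fun z1 _ => ed x z1 z
  have hcap : 0 ≤ wiretapCapZ1 W := by
    unfold wiretapCapZ1
    by_cases hbd : BddAbove {r : ℝ | ∃ (k : ℕ) (p : Fin k × 𝒳 → ℝ), IsPMF p ∧
        r = mutInfo (fun q : Fin k × 𝒴 => ∑ x, p (q.1, x) * WY W x q.2) -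
        mutInfo (fun q : Fin k × 𝒵₁ => ∑ x, p (q.1, x) * WZ1 W x q.2)}
    · refine le_csSup hbd ⟨1, fun s => rX s.2, ⟨fun s => hrX'.1 _, ?_⟩, ?_⟩
      · simp only [Fintype.sum_prod_type, Finset.univ_unique, Finset.sum_singleton]
        exact hrX'.2
      · have triv : ∀ {Z : Type} [Fintype Z] (w : 𝒳 → Z → ℝ), IsChannel w →
            mutInfo (fun q : Fin 1 × Z => ∑ x, rX x * w x q.2) = 0 := by
          intro Z _ w hw
          unfold mutInfo
          apply Finset.sum_eq_zero
          intro s _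
          have t1 : ∑ z, ∑ x, rX x * w x z = 1 := by
            rw [Finset.sum_comm]
            simp_rw [← Finset.mul_sum, (hw _).2, mul_one]
            exact hrX'.2
          simp only [t1, Finset.univ_unique, Finset.sum_singleton, one_mul]
          by_cases h0 : ∑ x, rX x * w x s.2 = 0
          · rw [h0]; simp
          · rw [div_self h0]; simp
        rw [triv _ (WY_chan hW), triv _ (WZ1_chan hW), sub_zero]
    · rw [Real.sSup_of_not_bddAbove hbd]
  have hb1 : infVU pU q (cc κ (WZ1 W)) ≤ infVU pU q (cc κ (WY W)) := by linarith
  refine ⟨_, _, ?_, ?_, core W hW hκ hp hq hUY hb1 hb2, heq, ?_⟩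
  · linarith
  · linarith
  · rw [← hopt]; ring
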